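/- Let B₁, B₂ ∈ C^{k-1,α}(D) be n×n matrix functions, k ≥ 1, 0 < α < 1. Then for every choice of vectors a₀, a₁, …, a_k ∈ ℂⁿ there exists a solution u ∈ C^{k,α}(D;ℂⁿ) of the equation ∂u/∂ζ̄ = B₁u + B₂ū on D such that ∂_ζ^j u(0) = a_j for 0 ≤ j ≤ k. -/

import Mathlib

open Complex MeasureTheory Real Matrix

/-- The open unit disc in `ℂ`. -/
def unitDisc : Set ℂ := Metric.ball (0 : ℂ) 1

/-- Componentwise complex conjugate of a vector in `ℂⁿ`. -/
def vecConj {n : ℕ} (u : Fin n → ℂ) : Fin n → ℂ := fun j => (starRingEnd ℂ) (u j)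

/-- The Wirtinger derivative `∂_ζ f = (∂f/∂ξ - i ∂f/∂η)/2`. -/
noncomputable def wirtingerZ {E : Type*} [NormedAddCommGroup E] [NormedSpace ℂ E]
    (f : ℂ → E) : ℂ → E :=
  fun ζ => (1 / 2 : ℂ) • (fderiv ℝ f ζ 1 - Complex.I • fderiv ℝ f ζ Complex.I)

/-- The Wirtinger derivative `∂_ζ̄ f = (∂f/∂ξ + i ∂f/∂η)/2`. -/
noncomputable def wirtingerZbar {E : Type*} [NormedAddCommGroup E] [NormedSpace ℂ E]
    (f : ℂ → E) : ℂ → E :=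
  fun ζ => (1 / 2 : ℂ) • (fderiv ℝ f ζ 1 + Complex.I • fderiv ℝ f ζ Complex.I)

/-- Membership in the Hölder space `C^{k,α}(s)`: `f` is `C^k` on `s` and its
`k`-th derivative is `α`-Hölder on `s`. -/
def HolderOn {E : Type*} [NormedAddCommGroup E] [NormedSpace ℝ E]
    (k : ℕ) (α : ℝ) (s : Set ℂ) (f : ℂ → E) : Prop :=
  ContDiffOn ℝ k f s ∧ ∃ C > 0, ∀ x ∈ s, ∀ y ∈ s,
    ‖iteratedFDerivWithin ℝ k f s x - iteratedFDerivWithin ℝ k f s y‖ ≤ C * ‖x - y‖ ^ α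

/-! ### Wirtinger calculus -/

/-- The real-linear map `h ↦ a h + b h̄`. -/
noncomputable def WL (a b : ℂ) : ℂ →L[ℝ] ℂ :=
  (ContinuousLinearMap.mul ℝ ℂ a) + (ContinuousLinearMap.mul ℝ ℂ b).comp
    (Complex.conjCLE : ℂ →L[ℝ] ℂ)

lemma WL_apply (a b h : ℂ) : WL a b h = a * h + b * (starRingEnd ℂ) h := by
  simp [WL]

lemma WL_norm_le (a b : ℂ) : ‖WL a b‖ ≤ ‖a‖ + ‖b‖ := by
  refine ContinuousLinearMap.opNorm_le_bound _ (by positivity) fun h => ?_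
  rw [WL_apply]
  refine (norm_add_le _ _).trans ?_
  simp [add_mul]

lemma WL_surj (L : ℂ →L[ℝ] ℂ) :
    L = WL ((1 / 2 : ℂ) • (L 1 - Complex.I • L Complex.I))
      ((1 / 2 : ℂ) • (L 1 + Complex.I • L Complex.I)) := by
  ext h
  have hh : h = h.re • (1 : ℂ) + h.im • Complex.I := by simp
  rw [WL_apply]
  conv_lhs => rw [hh]
  rw [map_add, map_smul, map_smul]
  have hc : (starRingEnd ℂ) h = h.re - h.im * Complex.I := by
    apply Complex.ext <;> simp
  have hh' : h = h.re + h.im * Complex.I := by simp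
  rw [hc]
  simp only [Complex.real_smul, smul_eq_mul]
  linear_combination ((h.im:ℂ) * L Complex.I) * Complex.I_sq -
    (1 / 2) * (L 1 - Complex.I * L Complex.I) * hh'

lemma WL_fst (a b : ℂ) :
    (1 / 2 : ℂ) • (WL a b 1 - Complex.I • WL a b Complex.I) = a := by
  simp only [WL_apply, smul_eq_mul, Complex.conj_I, map_one]
  linear_combination (-(a - b) / 2) * Complex.I_sq

lemma WL_snd (a b : ℂ) :
    (1 / 2 : ℂ) • (WL a b 1 + Complex.I • WL a b Complex.I) = b := by
  simp only [WL_apply, smul_eq_mul, Complex.conj_I, map_one]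
  linear_combination ((a - b) / 2) * Complex.I_sq

lemma hw_const (c : ℂ) (s : Set ℂ) (z : ℂ) : HasFDerivWithinAt (fun _ => c) (WL 0 0) s z := by
  have : WL 0 0 = 0 := by ext h; simp [WL_apply]
  rw [this]; exact hasFDerivWithinAt_const c z s

lemma hw_add {f g : ℂ → ℂ} {a b a' b' z : ℂ} {s : Set ℂ}
    (hf : HasFDerivWithinAt f (WL a b) s z) (hg : HasFDerivWithinAt g (WL a' b') s z) :
    HasFDerivWithinAt (fun z => f z + g z) (WL (a + a') (b + b')) s z := by
  have : WL (a + a') (b + b') = WL a b + WL a' b' := by ext h; simp [WL_apply]; ring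
  rw [this]; exact hf.add hg

lemma hw_mul {f g : ℂ → ℂ} {a b a' b' z : ℂ} {s : Set ℂ}
    (hf : HasFDerivWithinAt f (WL a b) s z) (hg : HasFDerivWithinAt g (WL a' b') s z) :
    HasFDerivWithinAt (fun z => f z * g z) (WL (a * g z + f z * a') (b * g z + f z * b')) s z := by
  have : WL (a * g z + f z * a') (b * g z + f z * b') = f z • WL a' b' + g z • WL a b := by
    ext h; simp [WL_apply]; ring
  rw [this]; exact hf.mul hg

lemma hw_conj {f : ℂ → ℂ} {a b z : ℂ} {s : Set ℂ}
    (hf : HasFDerivWithinAt f (WL a b) s z) :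
    HasFDerivWithinAt (fun z => (starRingEnd ℂ) (f z))
      (WL ((starRingEnd ℂ) b) ((starRingEnd ℂ) a)) s z := by
  have := (Complex.conjCLE : ℂ →L[ℝ] ℂ).hasFDerivAt.comp_hasFDerivWithinAt z hf
  refine this.congr_fderiv ?_
  ext h; simp [WL_apply]; ring

lemma hw_of_hasDerivAt {f : ℂ → ℂ} {a z : ℂ} {s : Set ℂ} (hf : HasDerivAt f a z) :
    HasFDerivWithinAt f (WL a 0) s z := by
  have := (hf.hasFDerivAt.restrictScalars ℝ).hasFDerivWithinAt (s := s)
  refine this.congr_fderiv ?_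
  ext h; simp [WL_apply, mul_comm]

/-- Local Hölder classes, described by iterated Wirtinger derivatives. -/
def CH (α : ℝ) (s : Set ℂ) : ℕ → (ℂ → ℂ) → Prop
  | 0, f => ∀ R : ℝ, ∃ C : ℝ, 0 ≤ C ∧ ∀ x ∈ s, ∀ y ∈ s, ‖x‖ ≤ R → ‖y‖ ≤ R →
      ‖f x - f y‖ ≤ C * ‖x - y‖ ^ α
  | (m + 1), f => ∃ f1 f2 : ℂ → ℂ, CH α s m f1 ∧ CH α s m f2 ∧
      ∀ z ∈ s, HasFDerivWithinAt f (WL (f1 z) (f2 z)) s z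

section basics
variable {α : ℝ} {s : Set ℂ}

lemma CH_zero_bound (hα : 0 < α) {f : ℂ → ℂ} (hf : CH α s 0 f) (R : ℝ) :
    ∃ C : ℝ, 0 ≤ C ∧ ∀ x ∈ s, ‖x‖ ≤ R → ‖f x‖ ≤ C := by
  obtain ⟨C, hC, h⟩ := hf R
  by_cases hne : ∃ x0 ∈ s, ‖x0‖ ≤ R
  · obtain ⟨x0, hx0, hx0R⟩ := hne
    refine ⟨‖f x0‖ + C * (2 * R) ^ α, ?_, fun x hx hxR => ?_⟩
    · have : 0 ≤ R := (norm_nonneg _).trans hx0R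
      positivity
    · have h1 := h x hx x0 hx0 hxR hx0R
      have h2 : ‖x - x0‖ ^ α ≤ (2 * R) ^ α := by
        apply Real.rpow_le_rpow (norm_nonneg _) _ hα.le
        have := norm_sub_le x x0; linarith
      have h3 : ‖f x‖ ≤ ‖f x0‖ + ‖f x - f x0‖ := by
        have := norm_add_le (f x0) (f x - f x0); simpa using this
      have := mul_le_mul_of_nonneg_left h2 hC
      linarith
  · push Not at hne
    exact ⟨0, le_rfl, fun x hx hxR => absurd hxR (not_le.mpr (hne x hx))⟩

lemma lip_to_hol (hα₁ : α < 1) {R C : ℝ} (hC : 0 ≤ C) {x y : ℂ} (hx : ‖x‖ ≤ R) (hy : ‖y‖ ≤ R) :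
    C * ‖x - y‖ ≤ (C * (2 * R) ^ (1 - α)) * ‖x - y‖ ^ α := by
  have h0 := norm_nonneg (x - y)
  have h1 : ‖x - y‖ ≤ 2 * R := by have := norm_sub_le x y; linarith
  rcases h0.eq_or_lt with h | h
  · rw [← h]; simp
    have : 0 ≤ R := (norm_nonneg _).trans hx
    positivity
  · have : ‖x - y‖ = ‖x - y‖ ^ (1 - α) * ‖x - y‖ ^ α := by
      rw [← Real.rpow_add h]; simp
    calc C * ‖x - y‖ = C * (‖x - y‖ ^ (1 - α) * ‖x - y‖ ^ α) := by rw [← this]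
      _ ≤ C * ((2 * R) ^ (1 - α) * ‖x - y‖ ^ α) := by
        gcongr
      _ = _ := by ring

lemma CH_zero_of_deriv (hα₁ : α < 1) (hs : Convex ℝ s) {f : ℂ → ℂ} {f' : ℂ → ℂ →L[ℝ] ℂ}
    (hf : ∀ z ∈ s, HasFDerivWithinAt f (f' z) s z)
    (hb : ∀ R : ℝ, ∃ C : ℝ, 0 ≤ C ∧ ∀ x ∈ s, ‖x‖ ≤ R → ‖f' x‖ ≤ C) : CH α s 0 f := by
  intro R
  obtain ⟨C, hC, h⟩ := hb R
  rcases lt_or_ge R 0 with hR | hR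
  · exact ⟨0, le_rfl, fun x _ _ _ hx => absurd hx (not_le.mpr (hR.trans_le (norm_nonneg _)))⟩
  refine ⟨C * (2 * R) ^ (1 - α), by positivity, fun x hx y hy hxR hyR => ?_⟩
  have hcv : Convex ℝ (s ∩ Metric.closedBall 0 R) := hs.inter (convex_closedBall _ _)
  have := hcv.norm_image_sub_le_of_norm_hasFDerivWithin_le (f := f) (f' := f') (C := C)
    (fun z hz => (hf z hz.1).mono Set.inter_subset_left)
    (fun z hz => h z hz.1 (by simpa using hz.2))
    (x := y) (y := x) ⟨hy, by simpa using hyR⟩ ⟨hx, by simpa using hxR⟩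
  exact this.trans (lip_to_hol hα₁ hC hxR hyR)

lemma CH_down (hα : 0 < α) (hα₁ : α < 1) (hs : Convex ℝ s) :
    ∀ (m : ℕ) (f : ℂ → ℂ), CH α s (m + 1) f → CH α s m f
  | 0, f, ⟨f1, f2, h1, h2, h⟩ => by
      refine CH_zero_of_deriv hα₁ hs h fun R => ?_
      obtain ⟨C1, hC1, b1⟩ := CH_zero_bound hα h1 R
      obtain ⟨C2, hC2, b2⟩ := CH_zero_bound hα h2 R
      exact ⟨C1 + C2, by positivity, fun x hx hxR =>
        (WL_norm_le _ _).trans (add_le_add (b1 x hx hxR) (b2 x hx hxR))⟩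
  | (m + 1), f, ⟨f1, f2, h1, h2, h⟩ =>
      ⟨f1, f2, CH_down hα hα₁ hs m f1 h1, CH_down hα hα₁ hs m f2 h2, h⟩

lemma CH_le (hα : 0 < α) (hα₁ : α < 1) (hs : Convex ℝ s) {m k : ℕ} (hmk : m ≤ k) {f : ℂ → ℂ}
    (hf : CH α s k f) : CH α s m f := by
  induction k, hmk using Nat.le_induction with
  | base => exact hf
  | succ k _ ih => exact ih (CH_down hα hα₁ hs k f hf)

lemma CH_congr : ∀ (m : ℕ) {f g : ℂ → ℂ}, (∀ z ∈ s, f z = g z) → CH α s m f → CH α s m g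
  | 0, f, g, hfg, h => fun R => by
      obtain ⟨C, hC, h⟩ := h R
      refine ⟨C, hC, fun x hx y hy hxR hyR => ?_⟩
      rw [← hfg x hx, ← hfg y hy]; exact h x hx y hy hxR hyR
  | (m + 1), f, g, hfg, ⟨f1, f2, h1, h2, h⟩ =>
      ⟨f1, f2, h1, h2, fun z hz => (h z hz).congr (fun x hx => (hfg x hx).symm) (hfg z hz).symm⟩

lemma CH_mono {t : Set ℂ} (hst : s ⊆ t) : ∀ (m : ℕ) {f : ℂ → ℂ}, CH α t m f → CH α s m f
  | 0, f, h => fun R => by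
      obtain ⟨C, hC, h⟩ := h R
      exact ⟨C, hC, fun x hx y hy hxR hyR => h x (hst hx) y (hst hy) hxR hyR⟩
  | (m + 1), f, ⟨f1, f2, h1, h2, h⟩ =>
      ⟨f1, f2, CH_mono hst m h1, CH_mono hst m h2, fun z hz => (h z (hst hz)).mono hst⟩

lemma CH_const (c : ℂ) : ∀ m : ℕ, CH α s m (fun _ => c)
  | 0 => fun R => ⟨0, le_rfl, fun x _ y _ _ _ => by simp⟩
  | (m + 1) => ⟨fun _ => 0, fun _ => 0, CH_const 0 m, CH_const 0 m, fun z _ => hw_const c s z⟩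

lemma CH_add : ∀ (m : ℕ) {f g : ℂ → ℂ}, CH α s m f → CH α s m g → CH α s m (fun z => f z + g z)
  | 0, f, g, hf, hg => fun R => by
      obtain ⟨C, hC, h⟩ := hf R
      obtain ⟨C', hC', h'⟩ := hg R
      refine ⟨C + C', by positivity, fun x hx y hy hxR hyR => ?_⟩
      have h1 := h x hx y hy hxR hyR
      have h2 := h' x hx y hy hxR hyR
      calc ‖f x + g x - (f y + g y)‖ = ‖(f x - f y) + (g x - g y)‖ := by ring_nf
        _ ≤ ‖f x - f y‖ + ‖g x - g y‖ := norm_add_le _ _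
        _ ≤ _ := by linarith
  | (m + 1), f, g, ⟨f1, f2, h1, h2, h⟩, ⟨g1, g2, k1, k2, k⟩ =>
      ⟨_, _, CH_add m h1 k1, CH_add m h2 k2, fun z hz => hw_add (h z hz) (k z hz)⟩

lemma CH_conj : ∀ (m : ℕ) {f : ℂ → ℂ}, CH α s m f → CH α s m (fun z => (starRingEnd ℂ) (f z))
  | 0, f, hf => fun R => by
      obtain ⟨C, hC, h⟩ := hf R
      refine ⟨C, by positivity, fun x hx y hy hxR hyR => ?_⟩
      rw [← map_sub, RCLike.norm_conj]; exact h x hx y hy hxR hyR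
  | (m + 1), f, ⟨f1, f2, h1, h2, h⟩ =>
      ⟨_, _, CH_conj m h2, CH_conj m h1, fun z hz => hw_conj (h z hz)⟩

lemma CH_mul (hα : 0 < α) (hα₁ : α < 1) (hs : Convex ℝ s) : ∀ (m : ℕ) {f g : ℂ → ℂ},
    CH α s m f → CH α s m g → CH α s m (fun z => f z * g z)
  | 0, f, g, hf, hg => fun R => by
      obtain ⟨C, hC, h⟩ := hf R
      obtain ⟨C', hC', h'⟩ := hg R
      obtain ⟨A, hA, bf⟩ := CH_zero_bound hα hf R
      obtain ⟨A', hA', bg⟩ := CH_zero_bound hα hg R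
      refine ⟨C * A' + A * C', by positivity, fun x hx y hy hxR hyR => ?_⟩
      have h1 := h x hx y hy hxR hyR
      have h2 := h' x hx y hy hxR hyR
      calc ‖f x * g x - f y * g y‖ = ‖(f x - f y) * g x + f y * (g x - g y)‖ := by ring_nf
        _ ≤ ‖f x - f y‖ * ‖g x‖ + ‖f y‖ * ‖g x - g y‖ := by
          refine (norm_add_le _ _).trans ?_; rw [norm_mul, norm_mul]
        _ ≤ (C * ‖x - y‖ ^ α) * A' + A * (C' * ‖x - y‖ ^ α) := by
          gcongr
          · exact bg x hx hxR
          · exact bf y hy hyR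
        _ = _ := by ring
  | (m + 1), f, g, hf, hg => by
      have hf' := CH_down hα hα₁ hs m f hf
      have hg' := CH_down hα hα₁ hs m g hg
      obtain ⟨f1, f2, h1, h2, h⟩ := hf
      obtain ⟨g1, g2, k1, k2, k⟩ := hg
      exact ⟨_, _, CH_add m (CH_mul hα hα₁ hs m h1 hg') (CH_mul hα hα₁ hs m hf' k1),
        CH_add m (CH_mul hα hα₁ hs m h2 hg') (CH_mul hα hα₁ hs m hf' k2),
        fun z hz => hw_mul (h z hz) (k z hz)⟩

lemma CH_sum {ι : Type*} (m : ℕ) (t : Finset ι) {f : ι → ℂ → ℂ} (h : ∀ i ∈ t, CH α s m (f i)) :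
    CH α s m (fun z => ∑ i ∈ t, f i z) := by
  classical
  induction t using Finset.induction_on with
  | empty => simpa using CH_const (α := α) (s := s) 0 m
  | insert a t ha ih =>
    have : (fun z => ∑ i ∈ insert a t, f i z) = fun z => f a z + ∑ i ∈ t, f i z := by
      ext z; rw [Finset.sum_insert ha]
    rw [this]
    exact CH_add m (h a (Finset.mem_insert_self _ _))
      (ih fun i hi => h i (Finset.mem_insert_of_mem hi))

lemma contDiff_wirtingerZ {f : ℂ → ℂ} (hf : ContDiff ℝ (⊤ : ℕ∞) f) :
    ContDiff ℝ (⊤ : ℕ∞) (wirtingerZ f) := by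
  have h : ContDiff ℝ (⊤ : ℕ∞) (fderiv ℝ f) := hf.fderiv_right (by simp)
  unfold wirtingerZ
  have h1 : ContDiff ℝ (⊤ : ℕ∞) (fun z => fderiv ℝ f z 1) := h.clm_apply contDiff_const
  have h2 : ContDiff ℝ (⊤ : ℕ∞) (fun z => fderiv ℝ f z Complex.I) := h.clm_apply contDiff_const
  exact ContDiff.smul (𝕜' := ℂ) contDiff_const (h1.sub (ContDiff.smul (𝕜' := ℂ) contDiff_const h2))

lemma contDiff_wirtingerZbar {f : ℂ → ℂ} (hf : ContDiff ℝ (⊤ : ℕ∞) f) :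
    ContDiff ℝ (⊤ : ℕ∞) (wirtingerZbar f) := by
  have h : ContDiff ℝ (⊤ : ℕ∞) (fderiv ℝ f) := hf.fderiv_right (by simp)
  unfold wirtingerZbar
  have h1 : ContDiff ℝ (⊤ : ℕ∞) (fun z => fderiv ℝ f z 1) := h.clm_apply contDiff_const
  have h2 : ContDiff ℝ (⊤ : ℕ∞) (fun z => fderiv ℝ f z Complex.I) := h.clm_apply contDiff_const
  exact ContDiff.smul (𝕜' := ℂ) contDiff_const (h1.add (ContDiff.smul (𝕜' := ℂ) contDiff_const h2))

lemma hasFDerivAt_WL {f : ℂ → ℂ} {z : ℂ} (hf : DifferentiableAt ℝ f z) :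
    HasFDerivAt f (WL (wirtingerZ f z) (wirtingerZbar f z)) z := by
  have := hf.hasFDerivAt
  rwa [WL_surj (fderiv ℝ f z)] at this

lemma wirtinger_of_hasFDerivAt {f : ℂ → ℂ} {z a b : ℂ} (hf : HasFDerivAt f (WL a b) z) :
    wirtingerZ f z = a ∧ wirtingerZbar f z = b := by
  constructor
  · simp only [wirtingerZ, hf.fderiv]; exact WL_fst a b
  · simp only [wirtingerZbar, hf.fderiv]; exact WL_snd a b

lemma CH_smooth (hα₁ : α < 1) (hs : Convex ℝ s) : ∀ (m : ℕ) {f : ℂ → ℂ},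
    ContDiff ℝ (⊤ : ℕ∞) f → CH α s m f
  | 0, f, hf => by
      refine CH_zero_of_deriv hα₁ hs (f' := fderiv ℝ f)
        (fun z _ => (hf.differentiable (by simp) z).hasFDerivAt.hasFDerivWithinAt) fun R => ?_
      have hc : Continuous (fderiv ℝ f) := hf.continuous_fderiv (by simp)
      obtain ⟨C, hC⟩ := (isCompact_closedBall (0 : ℂ) R).exists_bound_of_continuousOn hc.continuousOn
      exact ⟨max C 0, le_max_right _ _, fun x _ hx => (hC x (by simpa using hx)).trans
        (le_max_left _ _)⟩
  | (m + 1), f, hf => ⟨_, _, CH_smooth hα₁ hs m (contDiff_wirtingerZ hf),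
      CH_smooth hα₁ hs m (contDiff_wirtingerZbar hf),
      fun z _ => (hasFDerivAt_WL (hf.differentiable (by simp) z)).hasFDerivWithinAt⟩

lemma CH_continuous (hα : 0 < α) {f : ℂ → ℂ} (hf : CH α Set.univ 0 f) : Continuous f := by
  rw [continuous_iff_continuousAt]
  intro z
  obtain ⟨C, hC, h⟩ := hf (‖z‖ + 1)
  rw [ContinuousAt, tendsto_iff_norm_sub_tendsto_zero]
  have ht : Filter.Tendsto (fun x : ℂ => C * ‖x - z‖ ^ α) (nhds z) (nhds 0) := by
    have : Continuous (fun x : ℂ => C * ‖x - z‖ ^ α) :=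
      continuous_const.mul (((continuous_id.sub continuous_const).norm).rpow_const
        (fun _ => Or.inr hα.le))
    have h2 := this.tendsto z
    simpa [Real.zero_rpow hα.ne'] using h2
  refine squeeze_zero' (Filter.Eventually.of_forall fun _ => norm_nonneg _) ?_ ht
  filter_upwards [Metric.ball_mem_nhds z one_pos] with x hx
  refine h x trivial z trivial ?_ (by linarith)
  have : ‖x - z‖ < 1 := by simpa [dist_eq_norm] using hx
  have h3 := norm_add_le (x - z) z
  simp at h3
  linarith

end basics

/-! ### Conversion between `HolderOn` and `CH` -/

section conversion
variable {E F : Type*} [NormedAddCommGroup E] [NormedSpace ℝ E] [NormedAddCommGroup F]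
  [NormedSpace ℝ F] {α : ℝ} {s : Set ℂ}

lemma HolderOn.clm (hs : UniqueDiffOn ℝ s) {k : ℕ} {f : ℂ → E} (hf : HolderOn k α s f)
    (L : E →L[ℝ] F) : HolderOn k α s (fun z => L (f z)) := by
  obtain ⟨h1, C, hC, h⟩ := hf
  refine ⟨L.contDiff.comp_contDiffOn h1, (‖L‖ + 1) * C, by positivity, fun x hx y hy => ?_⟩
  have e : ∀ x ∈ s, iteratedFDerivWithin ℝ k (fun z => L (f z)) s x =
      L.compContinuousMultilinearMap (iteratedFDerivWithin ℝ k f s x) := fun x hx =>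
    L.iteratedFDerivWithin_comp_left (h1 x hx) hs hx le_rfl
  rw [e x hx, e y hy]
  have e2 : L.compContinuousMultilinearMap (iteratedFDerivWithin ℝ k f s x) -
      L.compContinuousMultilinearMap (iteratedFDerivWithin ℝ k f s y) =
      L.compContinuousMultilinearMap (iteratedFDerivWithin ℝ k f s x -
        iteratedFDerivWithin ℝ k f s y) := by
    ext m; simp
  rw [e2]
  refine (L.norm_compContinuousMultilinearMap_le _).trans ?_
  have := h x hx y hy
  calc _ ≤ (‖L‖ + 1) * (C * ‖x - y‖ ^ α) := by gcongr; linarith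
    _ = _ := by ring

lemma HolderOn.add (hs : UniqueDiffOn ℝ s) {k : ℕ} {f g : ℂ → E} (hf : HolderOn k α s f)
    (hg : HolderOn k α s g) : HolderOn k α s (fun z => f z + g z) := by
  obtain ⟨h1, C, hC, h⟩ := hf
  obtain ⟨k1, D, hD, k⟩ := hg
  refine ⟨h1.add k1, C + D, by positivity, fun x hx y hy => ?_⟩
  rw [fun_iteratedFDerivWithin_add_apply (h1 x hx) (k1 x hx) hs hx,
    fun_iteratedFDerivWithin_add_apply (h1 y hy) (k1 y hy) hs hy, add_sub_add_comm]
  refine (norm_add_le _ _).trans ?_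
  have := h x hx y hy
  have := k x hx y hy
  linarith

lemma HolderOn.zero_fun (k : ℕ) : HolderOn k α s (fun _ => (0 : E)) := by
  refine ⟨contDiffOn_const, 1, one_pos, fun x hx y hy => ?_⟩
  have : iteratedFDerivWithin ℝ k (fun _ : ℂ => (0 : E)) s = 0 := iteratedFDerivWithin_fun_zero
  rw [this]; simp; positivity

lemma HolderOn.sum (hs : UniqueDiffOn ℝ s) {ι : Type*} {k : ℕ} (t : Finset ι) {f : ι → ℂ → E}
    (hf : ∀ i ∈ t, HolderOn k α s (f i)) : HolderOn k α s (fun z => ∑ i ∈ t, f i z) := by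
  classical
  induction t using Finset.induction_on with
  | empty => simpa using HolderOn.zero_fun k
  | insert a t ha ih =>
    have : (fun z => ∑ i ∈ insert a t, f i z) = fun z => f a z + ∑ i ∈ t, f i z := by
      ext z; rw [Finset.sum_insert ha]
    rw [this]
    exact HolderOn.add hs (hf a (Finset.mem_insert_self _ _))
      (ih fun i hi => hf i (Finset.mem_insert_of_mem hi))

lemma HolderOn.congr {k : ℕ} {f g : ℂ → E} (hf : HolderOn k α s f)
    (h : ∀ z ∈ s, f z = g z) : HolderOn k α s g := by
  obtain ⟨h1, C, hC, hh⟩ := hf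
  refine ⟨h1.congr fun x hx => (h x hx).symm, C, hC, fun x hx y hy => ?_⟩
  rw [iteratedFDerivWithin_congr (fun x hx => (h x hx).symm) hx,
    iteratedFDerivWithin_congr (fun x hx => (h x hx).symm) hy]
  exact hh x hx y hy

lemma HolderOn_succ_iff (hs : UniqueDiffOn ℝ s) {k : ℕ} {f : ℂ → E} :
    HolderOn (k + 1) α s f ↔ DifferentiableOn ℝ f s ∧ HolderOn k α s (fderivWithin ℝ f s) := by
  have hn : ∀ x ∈ s, ∀ y ∈ s, ‖iteratedFDerivWithin ℝ (k + 1) f s x -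
      iteratedFDerivWithin ℝ (k + 1) f s y‖ =
      ‖iteratedFDerivWithin ℝ k (fderivWithin ℝ f s) s x -
        iteratedFDerivWithin ℝ k (fderivWithin ℝ f s) s y‖ := by
    intro x hx y hy
    rw [iteratedFDerivWithin_succ_eq_comp_right hs hx, iteratedFDerivWithin_succ_eq_comp_right hs hy]
    simp only [Function.comp_apply]
    rw [← dist_eq_norm, ← dist_eq_norm]
    exact LinearIsometryEquiv.dist_map _ _ _
  constructor
  · rintro ⟨h1, C, hC, h⟩
    have h1' : ContDiffOn ℝ ((k : WithTop ℕ∞) + 1) f s := by exact_mod_cast h1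
    rw [contDiffOn_succ_iff_fderivWithin hs] at h1'
    exact ⟨h1'.1, h1'.2.2, C, hC, fun x hx y hy => by rw [← hn x hx y hy]; exact h x hx y hy⟩
  · rintro ⟨h0, h1, C, hC, h⟩
    refine ⟨?_, C, hC, fun x hx y hy => by rw [hn x hx y hy]; exact h x hx y hy⟩
    have : ContDiffOn ℝ ((k : WithTop ℕ∞) + 1) f s := by
      rw [contDiffOn_succ_iff_fderivWithin hs]
      exact ⟨h0, by simp, h1⟩
    exact_mod_cast this

lemma HolderOn_zero_iff {f : ℂ → E} :
    HolderOn 0 α s f ↔ ContinuousOn f s ∧ ∃ C > 0, ∀ x ∈ s, ∀ y ∈ s,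
      ‖f x - f y‖ ≤ C * ‖x - y‖ ^ α := by
  unfold HolderOn
  have : ∀ x y, ‖iteratedFDerivWithin ℝ 0 f s x - iteratedFDerivWithin ℝ 0 f s y‖ =
      ‖f x - f y‖ := by
    intro x y
    rw [iteratedFDerivWithin_zero_eq_comp]
    simp only [Function.comp_apply]
    rw [← map_sub, LinearIsometryEquiv.norm_map]
  simp only [this]
  simp

end conversion

lemma CH_of_HolderOn {α : ℝ} {s : Set ℂ} (hs : UniqueDiffOn ℝ s) : ∀ (k : ℕ) {f : ℂ → ℂ},
    HolderOn k α s f → CH α s k f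
  | 0, f, hf => fun R => by
      obtain ⟨-, C, hC, h⟩ := HolderOn_zero_iff.mp hf
      exact ⟨C, hC.le, fun x hx y hy _ _ => h x hx y hy⟩
  | (k + 1), f, hf => by
      obtain ⟨hd, h⟩ := (HolderOn_succ_iff hs).mp hf
      have h1 := h.clm hs (ContinuousLinearMap.apply ℝ ℂ (1 : ℂ))
      have hI := h.clm hs (ContinuousLinearMap.apply ℝ ℂ Complex.I)
      have c1 := CH_of_HolderOn hs k h1
      have cI := CH_of_HolderOn hs k hI
      have m1 := h1.clm hs (ContinuousLinearMap.mul ℝ ℂ (1 / 2))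
      have mI := hI.clm hs (ContinuousLinearMap.mul ℝ ℂ (1 / 2 * Complex.I))
      have mI' := hI.clm hs (ContinuousLinearMap.mul ℝ ℂ (-(1 / 2 * Complex.I)))
      refine ⟨_, _, CH_of_HolderOn hs k (m1.add hs mI'), CH_of_HolderOn hs k (m1.add hs mI),
        fun z hz => ?_⟩
      have := (hd z hz).hasFDerivWithinAt
      rw [WL_surj (fderivWithin ℝ f s z)] at this
      refine this.congr_fderiv ?_
      congr 1
      · simp; ring
      · simp; ring

lemma HolderOn_of_CH {α : ℝ} (hα : 0 < α) {s : Set ℂ} (hs : UniqueDiffOn ℝ s) (R : ℝ)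
    (hR : ∀ x ∈ s, ‖x‖ ≤ R) : ∀ (k : ℕ) {f : ℂ → ℂ}, CH α s k f → HolderOn k α s f
  | 0, f, hf => by
      obtain ⟨C, hC, h⟩ := hf R
      refine HolderOn_zero_iff.mpr ⟨?_, C + 1, by positivity, fun x hx y hy => ?_⟩
      · intro z hz
        rw [ContinuousWithinAt, tendsto_iff_norm_sub_tendsto_zero]
        have ht : Filter.Tendsto (fun x : ℂ => C * ‖x - z‖ ^ α) (nhdsWithin z s) (nhds 0) := by
          have : Continuous (fun x : ℂ => C * ‖x - z‖ ^ α) :=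
            continuous_const.mul (((continuous_id.sub continuous_const).norm).rpow_const
              (fun _ => Or.inr hα.le))
          have h2 := this.tendsto z
          refine Filter.Tendsto.mono_left ?_ nhdsWithin_le_nhds
          simpa [Real.zero_rpow hα.ne'] using h2
        refine squeeze_zero' (Filter.Eventually.of_forall fun _ => norm_nonneg _) ?_ ht
        filter_upwards [self_mem_nhdsWithin] with x hx
        exact h x hx z hz (hR x hx) (hR z hz)
      · refine (h x hx y hy (hR x hx) (hR y hy)).trans ?_
        gcongr; linarith
  | (k + 1), f, ⟨f1, f2, h1, h2, h⟩ => by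
      refine (HolderOn_succ_iff hs).mpr ⟨fun z hz => (h z hz).differentiableWithinAt, ?_⟩
      have a1 := HolderOn_of_CH hα hs R hR k h1
      have a2 := HolderOn_of_CH hα hs R hR k h2
      have b1 := a1.clm hs (ContinuousLinearMap.mul ℝ ℂ)
      have b2 := a2.clm hs (((ContinuousLinearMap.compL ℝ ℂ ℂ ℂ).flip
        (Complex.conjCLE : ℂ →L[ℝ] ℂ)).comp (ContinuousLinearMap.mul ℝ ℂ))
      refine (b1.add hs b2).congr fun z hz => ?_
      rw [(h z hz).fderivWithin (hs z hz)]
      rfl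

lemma HolderOn_pi {n : ℕ} {α : ℝ} {s : Set ℂ} (hs : UniqueDiffOn ℝ s) {k : ℕ}
    {u : ℂ → Fin n → ℂ} (h : ∀ i, HolderOn k α s (fun z => u z i)) : HolderOn k α s u := by
  have := HolderOn.sum hs (Finset.univ) (f := fun i z =>
    (ContinuousLinearMap.single ℝ (fun _ : Fin n => ℂ) i) (u z i))
    (fun i _ => (h i).clm hs _)
  refine this.congr fun z _ => ?_
  ext j
  simp [Finset.sum_apply, Pi.single_apply]

/-! ### Extension from the closed disc -/

/-- higher-order reflection maps in the unit circle -/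
noncomputable def psiR (i : ℕ) (z : ℂ) : ℂ := (z⁻¹) ^ i * ((starRingEnd ℂ) (z⁻¹)) ^ (i + 1)

lemma psiR_norm_le (i : ℕ) {z : ℂ} (hz : 1 ≤ ‖z‖) : ‖psiR i z‖ ≤ 1 := by
  unfold psiR
  rw [norm_mul, norm_pow, norm_pow, RCLike.norm_conj, norm_inv]
  have : ‖z‖⁻¹ ≤ 1 := inv_le_one_of_one_le₀ hz
  exact mul_le_one₀ (pow_le_one₀ (by positivity) this) (by positivity)
    (pow_le_one₀ (by positivity) this)

lemma psiR_circle (i : ℕ) {z : ℂ} (hz : ‖z‖ = 1) : psiR i z = z := by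
  unfold psiR
  have h : z * (starRingEnd ℂ) z = 1 := by rw [Complex.mul_conj, Complex.normSq_eq_norm_sq, hz]; simp
  have hz0 : z ≠ 0 := by rintro rfl; simp at hz
  have h1 : z⁻¹ = (starRingEnd ℂ) z := by field_simp; rw [h]
  rw [h1, Complex.conj_conj, pow_succ, ← mul_assoc, ← mul_pow, mul_comm ((starRingEnd ℂ) z), h]
  simp

lemma psiR_lip (i : ℕ) : ∃ L : ℝ, 0 ≤ L ∧ ∀ x y : ℂ, 1 ≤ ‖x‖ → 1 ≤ ‖y‖ →
    ‖psiR i x - psiR i y‖ ≤ L * ‖x - y‖ := by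
  let g : ℂ → ℂ := fun w => w ^ i * ((starRingEnd ℂ) w) ^ (i + 1)
  have hg : ContDiff ℝ 1 g :=
    (contDiff_id.pow i).mul ((Complex.conjCLE : ℂ →L[ℝ] ℂ).contDiff.pow (i + 1))
  have hc : Continuous (fderiv ℝ g) := hg.continuous_fderiv (by simp)
  obtain ⟨C, hC⟩ := (isCompact_closedBall (0 : ℂ) 1).exists_bound_of_continuousOn hc.continuousOn
  have hC0 : 0 ≤ C := (norm_nonneg _).trans (hC 0 (by simp))
  refine ⟨C, hC0, fun x y hx hy => ?_⟩
  have hx0 : x ≠ 0 := by rintro rfl; norm_num at hx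
  have hy0 : y ≠ 0 := by rintro rfl; norm_num at hy
  have h1 := (convex_closedBall (0 : ℂ) 1).norm_image_sub_le_of_norm_hasFDerivWithin_le
    (f := g) (f' := fderiv ℝ g) (C := C)
    (fun z _ => (hg.differentiable (by simp) z).hasFDerivAt.hasFDerivWithinAt)
    (fun z hz => hC z hz) (x := y⁻¹) (y := x⁻¹)
    (by simpa using inv_le_one_of_one_le₀ hy) (by simpa using inv_le_one_of_one_le₀ hx)
  refine (show ‖psiR i x - psiR i y‖ ≤ _ from h1).trans ?_
  gcongr
  have : x⁻¹ - y⁻¹ = (y - x) * (x⁻¹ * y⁻¹) := by field_simp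
  rw [this, norm_mul, norm_mul, norm_inv, norm_inv, norm_sub_rev y x]
  have a1 : ‖x‖⁻¹ ≤ 1 := inv_le_one_of_one_le₀ hx
  have a2 : ‖y‖⁻¹ ≤ 1 := inv_le_one_of_one_le₀ hy
  have : ‖x‖⁻¹ * ‖y‖⁻¹ ≤ 1 := mul_le_one₀ a1 (by positivity) a2
  nlinarith [norm_nonneg (x - y)]

lemma hw_pow {f : ℂ → ℂ} {a b z : ℂ} {s : Set ℂ} (hf : HasFDerivWithinAt f (WL a b) s z) (n : ℕ) :
    HasFDerivWithinAt (fun z => f z ^ n) (WL (n * f z ^ (n - 1) * a) (n * f z ^ (n - 1) * b)) s z := by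
  have h : HasDerivAt (fun w : ℂ => w ^ n) (n * f z ^ (n - 1)) (f z) := hasDerivAt_pow n (f z)
  have := (h.hasFDerivAt.restrictScalars ℝ).comp_hasFDerivWithinAt z hf
  refine this.congr_fderiv ?_
  ext h; simp [WL_apply]; ring

lemma hw_psiR (i : ℕ) {z : ℂ} (hz : z ≠ 0) (s : Set ℂ) :
    HasFDerivWithinAt (psiR i) (WL (-(i : ℂ) * psiR i z / z)
      (-((i : ℂ) + 1) * psiR i z / (starRingEnd ℂ) z)) s z := by
  have h0 : HasFDerivWithinAt (fun z : ℂ => z⁻¹) (WL (-(z ^ 2)⁻¹) 0) s z :=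
    hw_of_hasDerivAt (hasDerivAt_inv hz)
  have h := hw_mul (hw_pow h0 i) (hw_pow (hw_conj h0) (i + 1))
  refine (show HasFDerivWithinAt (psiR i) _ s z from h).congr_fderiv ?_
  have hz' : (starRingEnd ℂ) z ≠ 0 := by simpa using hz
  congr 1
  · unfold psiR
    rcases i with _ | i
    · simp
    · simp [pow_succ]; field_simp; ring
  · unfold psiR
    simp [pow_succ]; field_simp; ring

lemma hw_comp {f g : ℂ → ℂ} {a b c d z : ℂ} {s t : Set ℂ}
    (hf : HasFDerivWithinAt f (WL a b) t (g z)) (hg : HasFDerivWithinAt g (WL c d) s z)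
    (hst : Set.MapsTo g s t) :
    HasFDerivWithinAt (fun z => f (g z)) (WL (a * c + b * (starRingEnd ℂ) d)
      (a * d + b * (starRingEnd ℂ) c)) s z := by
  refine (hf.comp z hg hst).congr_fderiv ?_
  ext h; simp [WL_apply]; ring

/-- extension operator by finite combinations of reflections -/
noncomputable def extR (N : ℕ) (c : ℕ → ℂ) (f : ℂ → ℂ) (z : ℂ) : ℂ :=
  if ‖z‖ ≤ 1 then f z else ∑ i ∈ Finset.range N, c i * f (psiR i z)

lemma extR_in {N : ℕ} {c : ℕ → ℂ} {f : ℂ → ℂ} {z : ℂ} (hz : ‖z‖ ≤ 1) : extR N c f z = f z := by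
  simp [extR, hz]

lemma extR_out {N : ℕ} {c : ℕ → ℂ} (hc : ∑ i ∈ Finset.range N, c i = 1) {f : ℂ → ℂ} {z : ℂ}
    (hz : 1 ≤ ‖z‖) : extR N c f z = ∑ i ∈ Finset.range N, c i * f (psiR i z) := by
  rcases hz.eq_or_lt with h | h
  · rw [extR_in h.symm.le]
    have : ∀ i ∈ Finset.range N, c i * f (psiR i z) = c i * f z := fun i _ => by
      rw [psiR_circle i h.symm]
    rw [Finset.sum_congr rfl this, ← Finset.sum_mul, hc, one_mul]
  · simp [extR, not_le.mpr h]

lemma exists_on_circle {x y : ℂ} (hx : ‖x‖ ≤ 1) (hy : 1 ≤ ‖y‖) :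
    ∃ w : ℂ, ‖w‖ = 1 ∧ ‖x - w‖ ≤ ‖x - y‖ ∧ ‖w - y‖ ≤ ‖x - y‖ := by
  have hc : ContinuousOn (fun t : ℝ => ‖x + (t : ℂ) * (y - x)‖) (Set.Icc 0 1) := by fun_prop
  have := intermediate_value_Icc (zero_le_one' ℝ) hc
  obtain ⟨t, ht, h⟩ := this (show (1 : ℝ) ∈ _ by constructor <;> simpa)
  refine ⟨x + t * (y - x), h, ?_, ?_⟩
  · have : x - (x + t * (y - x)) = t * (x - y) := by ring
    rw [this, norm_mul, Complex.norm_real, Real.norm_of_nonneg ht.1]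
    nlinarith [norm_nonneg (x - y), ht.2]
  · have : x + t * (y - x) - y = ((1 - t : ℝ) : ℂ) * (x - y) := by push_cast; ring
    rw [this, norm_mul, Complex.norm_real, Real.norm_of_nonneg (by linarith [ht.2])]
    nlinarith [norm_nonneg (x - y), ht.1]

lemma extR_zero {α : ℝ} (hα : 0 < α) {N : ℕ} {c : ℕ → ℂ} (hc : ∑ i ∈ Finset.range N, c i = 1)
    {f : ℂ → ℂ} (hf : CH α (Metric.closedBall 0 1) 0 f) : CH α Set.univ 0 (extR N c f) := by
  obtain ⟨C, hC, h⟩ := hf 1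
  choose L hL0 hL using psiR_lip
  set D : ℝ := ∑ i ∈ Finset.range N, ‖c i‖ * (C * (L i) ^ α) with hD
  have hD0 : 0 ≤ D := Finset.sum_nonneg fun i _ => by have := hL0 i; positivity
  have hin : ∀ x y : ℂ, ‖x‖ ≤ 1 → ‖y‖ ≤ 1 → ‖extR N c f x - extR N c f y‖ ≤ C * ‖x - y‖ ^ α := by
    intro x y hx hy
    rw [extR_in hx, extR_in hy]
    exact h x (by simpa using hx) y (by simpa using hy) hx hy
  have hout : ∀ x y : ℂ, 1 ≤ ‖x‖ → 1 ≤ ‖y‖ →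
      ‖extR N c f x - extR N c f y‖ ≤ D * ‖x - y‖ ^ α := by
    intro x y hx hy
    rw [extR_out hc hx, extR_out hc hy, ← Finset.sum_sub_distrib, hD, Finset.sum_mul]
    refine (norm_sum_le _ _).trans (Finset.sum_le_sum fun i _ => ?_)
    rw [← mul_sub, norm_mul, mul_assoc]
    gcongr
    have px := psiR_norm_le i hx
    have py := psiR_norm_le i hy
    refine (h _ (by simpa using px) _ (by simpa using py) px py).trans ?_
    rw [mul_assoc, ← Real.mul_rpow (hL0 i) (norm_nonneg _)]
    gcongr
    exact hL i x y hx hy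
  have hmix : ∀ x y : ℂ, ‖x‖ ≤ 1 → 1 ≤ ‖y‖ →
      ‖extR N c f x - extR N c f y‖ ≤ (C + D) * ‖x - y‖ ^ α := by
    intro x y hx hy
    obtain ⟨w, hw, h1, h2⟩ := exists_on_circle hx hy
    have e1 := hin x w hx hw.le
    have e2 := hout w y hw.ge hy
    have e3 : ‖x - w‖ ^ α ≤ ‖x - y‖ ^ α := by gcongr
    have e4 : ‖w - y‖ ^ α ≤ ‖x - y‖ ^ α := by gcongr
    have e5 := norm_sub_le_norm_sub_add_norm_sub (extR N c f x) (extR N c f w) (extR N c f y)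
    have e6 := mul_le_mul_of_nonneg_left e3 hC
    have e7 := mul_le_mul_of_nonneg_left e4 hD0
    linarith
  intro R
  refine ⟨C + D, by positivity, fun x _ y _ _ _ => ?_⟩
  have hp : 0 ≤ ‖x - y‖ ^ α := by positivity
  rcases le_total ‖x‖ 1 with hx | hx <;> rcases le_total ‖y‖ 1 with hy | hy
  · exact (hin x y hx hy).trans (by nlinarith)
  · exact hmix x y hx hy
  · rw [norm_sub_rev, norm_sub_rev x y]; exact hmix y x hy hx
  · exact (hout x y hx hy).trans (by nlinarith)

/-- a smooth function equal to `1/z` for `1 ≤ |z|` -/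
lemma exists_kappa : ∃ κ : ℂ → ℂ, ContDiff ℝ (⊤ : ℕ∞) κ ∧ ∀ z : ℂ, 1 ≤ ‖z‖ → κ z = z⁻¹ := by
  let b : ContDiffBump (0 : ℂ) := ⟨1 / 4, 1 / 2, by norm_num, by norm_num⟩
  refine ⟨fun z => ((1 - b z : ℝ) : ℂ) * z⁻¹, ?_, ?_⟩
  · rw [contDiff_iff_contDiffAt]
    intro z
    by_cases hz : z = 0
    · have : (fun z : ℂ => ((1 - b z : ℝ) : ℂ) * z⁻¹) =ᶠ[nhds z] fun _ => 0 := by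
        rw [hz]
        filter_upwards [Metric.closedBall_mem_nhds (0 : ℂ) (show (0 : ℝ) < 1 / 4 by norm_num)]
          with w hw
        rw [b.one_of_mem_closedBall hw]; simp
      exact contDiffAt_const.congr_of_eventuallyEq this
    · have h1 : ContDiffAt ℝ (⊤ : ℕ∞) (fun z : ℂ => ((1 - b z : ℝ) : ℂ)) z :=
        Complex.ofRealCLM.contDiff.contDiffAt.comp z (contDiffAt_const.sub b.contDiffAt)
      have h2 : ContDiffAt ℝ (⊤ : ℕ∞) (fun z : ℂ => z⁻¹) z := contDiffAt_inv ℝ hz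
      exact h1.mul h2
  · intro z hz
    have : b z = 0 := b.zero_of_le_dist (by simp [b]; linarith)
    simp [this]

/-- moment conditions -/
def Mom (N m : ℕ) (c : ℕ → ℂ) : Prop :=
  ∀ p ≤ m, ∑ i ∈ Finset.range N, c i * (-(2 * (i : ℂ) + 1)) ^ p = 1

lemma Mom.sum {N m : ℕ} {c : ℕ → ℂ} (h : Mom N m c) : ∑ i ∈ Finset.range N, c i = 1 := by
  simpa using h 0 (Nat.zero_le _)

lemma extR_CH {α : ℝ} (hα : 0 < α) (hα₁ : α < 1) (N : ℕ) : ∀ (m : ℕ) (c : ℕ → ℂ) (f : ℂ → ℂ),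
    Mom N m c → CH α (Metric.closedBall 0 1) m f → CH α Set.univ m (extR N c f)
  | 0, c, f, hc, hf => extR_zero hα hc.sum hf
  | (m + 1), c, f, hc, ⟨f1, f2, h1, h2, h⟩ => by
      obtain ⟨κ, hκ, hκz⟩ := exists_kappa
      have hD : Convex ℝ (Metric.closedBall (0 : ℂ) 1) := convex_closedBall _ _
      have hcl : Mom N m c := fun p hp => hc p (by omega)
      set c' : ℕ → ℂ := fun i => c i * (-(2 * (i : ℂ) + 1)) with hc'
      have hcm : Mom N m c' := fun p hp => by
        refine Eq.trans ?_ (hc (p + 1) (by omega))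
        refine Finset.sum_congr rfl fun i _ => ?_
        simp only [hc', pow_succ]; ring
      have hid : ∀ s : Set ℂ, Convex ℝ s → CH α s m (fun z => z) := fun s hs =>
        CH_smooth hα₁ hs m contDiff_id
      have hcj : ∀ s : Set ℂ, Convex ℝ s → CH α s m (fun z => (starRingEnd ℂ) z) := fun s hs =>
        CH_conj m (hid s hs)
      have hp := CH_mul hα hα₁ hD m (hid _ hD) h1
      have hq := CH_mul hα hα₁ hD m (hcj _ hD) h2
      have hpq : CH α (Metric.closedBall 0 1) m (fun z => z * f1 z + (-1) *
          ((starRingEnd ℂ) z * f2 z)) := CH_add m hp (CH_mul hα hα₁ hD m (CH_const (-1) m) hq)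
      have hpq' := CH_add m hp hq
      have E1 := extR_CH hα hα₁ N m c _ hcl hpq
      have E2 := extR_CH hα hα₁ N m c' _ hcm hpq'
      have E3 := extR_CH hα hα₁ N m c _ hcl h1
      have E4 := extR_CH hα hα₁ N m c _ hcl h2
      have hu : Convex ℝ (Set.univ : Set ℂ) := convex_univ
      have hk : CH α Set.univ m κ := CH_smooth hα₁ hu m hκ
      have hkb : CH α Set.univ m (fun z => (starRingEnd ℂ) (κ z)) := CH_conj m hk
      have cm := fun {f g : ℂ → ℂ} => CH_mul (f := f) (g := g) hα hα₁ hu m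
      have G1 := CH_add m (cm hk (CH_add m (cm (CH_const (1 / 2) m) E1)
          (cm (CH_const (1 / 2) m) E2)))
        (cm (CH_add m (CH_const 1 m) (cm (CH_const (-1) m) (cm hk (hid _ hu)))) E3)
      have G2 := CH_add m (cm hkb (CH_add m (cm (CH_const (-1 / 2) m) E1)
          (cm (CH_const (1 / 2) m) E2)))
        (cm (CH_add m (CH_const 1 m) (cm (CH_const (-1) m) (cm hkb (hcj _ hu)))) E4)
      refine ⟨_, _, G1, G2, fun z _ => ?_⟩
      have hun : (Metric.closedBall (0 : ℂ) 1) ∪ {z | 1 ≤ ‖z‖} = Set.univ := by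
        ext w; simp [le_total]
      rw [← hun]
      refine HasFDerivWithinAt.union ?_ ?_
      · by_cases hz : z ∈ Metric.closedBall (0 : ℂ) 1
        · have hz1 : ‖z‖ ≤ 1 := by simpa using hz
          refine ((h z hz).congr (fun x hx => extR_in (by simpa using hx)) (extR_in hz1)).congr_fderiv
            ?_
          simp only [extR_in hz1]
          congr 1 <;> ring
        · exact HasFDerivWithinAt.of_notMem_closure (by rwa [Metric.isClosed_closedBall.closure_eq])
      · have hO : IsClosed {z : ℂ | 1 ≤ ‖z‖} := isClosed_le continuous_const continuous_norm
        by_cases hz : z ∈ {z : ℂ | 1 ≤ ‖z‖}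
        · have hz1 : 1 ≤ ‖z‖ := hz
          have hz0 : z ≠ 0 := by rintro rfl; norm_num at hz1
          have hz0' : (starRingEnd ℂ) z ≠ 0 := by simpa using hz0
          have hd : ∀ i ∈ Finset.range N, HasFDerivWithinAt (fun z => c i * f (psiR i z)) _
              {z : ℂ | 1 ≤ ‖z‖} z := fun i _ => hw_mul (hw_const (c i) _ z)
              (hw_comp (h (psiR i z) (by simpa using psiR_norm_le i hz1)) (hw_psiR i hz0 _)
                (fun w hw => by simpa using psiR_norm_le i hw))
          have hs := HasFDerivWithinAt.fun_sum hd
          refine (hs.congr (fun x hx => extR_out hc.sum hx) (extR_out hc.sum hz1)).congr_fderiv ?_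
          have hWs : ∀ A B : ℕ → ℂ, ∑ i ∈ Finset.range N, WL (A i) (B i) =
              WL (∑ i ∈ Finset.range N, A i) (∑ i ∈ Finset.range N, B i) := by
            intro A B; ext w
            simp [WL_apply, Finset.sum_mul, Finset.sum_add_distrib]
          rw [hWs]
          simp only [extR_out hcl.sum hz1, extR_out hcm.sum hz1, hκz z hz1, map_inv₀]
          have k1 : z⁻¹ * z = 1 := inv_mul_cancel₀ hz0
          have k2 : ((starRingEnd ℂ) z)⁻¹ * (starRingEnd ℂ) z = 1 := inv_mul_cancel₀ hz0'
          rw [k1, k2]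
          congr 1
          · rw [Finset.mul_sum, Finset.mul_sum, ← Finset.sum_add_distrib, Finset.mul_sum]
            simp only [mul_one, add_neg_cancel, zero_mul, add_zero]
            refine Finset.sum_congr rfl fun i _ => ?_
            simp only [hc', map_div₀, map_mul, map_neg, map_add, map_one, map_natCast,
              Complex.conj_conj]
            field_simp
            ring
          · rw [Finset.mul_sum, Finset.mul_sum, ← Finset.sum_add_distrib, Finset.mul_sum]
            simp only [mul_one, add_neg_cancel, zero_mul, add_zero]
            refine Finset.sum_congr rfl fun i _ => ?_
            simp only [hc', map_div₀, map_mul, map_neg, map_natCast]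
            field_simp
            ring
        · exact HasFDerivWithinAt.of_notMem_closure (by rwa [hO.closure_eq])

lemma exists_Mom (m : ℕ) : ∃ c : ℕ → ℂ, Mom (m + 1) m c := by
  let v : ℕ → ℂ := fun i => -(2 * (i : ℂ) + 1)
  have hv : Set.InjOn v (Finset.range (m + 1) : Set ℕ) := by
    intro i _ j _ hij
    simp [v] at hij
    exact hij
  refine ⟨fun i => (Lagrange.basis (Finset.range (m + 1)) v i).eval 1, fun p hp => ?_⟩
  have h := Lagrange.eq_interpolate (f := (Polynomial.X ^ p : Polynomial ℂ)) hv (by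
    rw [Polynomial.degree_X_pow, Finset.card_range]; exact_mod_cast Nat.lt_succ_of_le hp)
  have h2 := congrArg (Polynomial.eval (1 : ℂ)) h
  rw [Lagrange.interpolate_apply, Polynomial.eval_finsetSum] at h2
  simp only [Polynomial.eval_pow, Polynomial.eval_X, one_pow, Polynomial.eval_mul,
    Polynomial.eval_C] at h2
  refine Eq.trans ?_ h2.symm
  exact Finset.sum_congr rfl fun i _ => by simp only [v]; ring

/-- compactly supported extension -/
lemma exists_extension {α : ℝ} (hα : 0 < α) (hα₁ : α < 1) (m : ℕ) {f : ℂ → ℂ}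
    (hf : CH α (Metric.closedBall 0 1) m f) : ∃ g : ℂ → ℂ, CH α Set.univ m g ∧
      (∀ z, ‖z‖ ≤ 1 → g z = f z) ∧ ∀ z, 2 ≤ ‖z‖ → g z = 0 := by
  obtain ⟨c, hc⟩ := exists_Mom m
  let b : ContDiffBump (0 : ℂ) := ⟨1, 2, by norm_num, by norm_num⟩
  refine ⟨fun z => ((b z : ℝ) : ℂ) * extR (m + 1) c f z, ?_, ?_, ?_⟩
  · refine CH_mul hα hα₁ convex_univ m (CH_smooth hα₁ convex_univ m ?_)
      (extR_CH hα hα₁ (m + 1) m c f hc hf)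
    exact Complex.ofRealCLM.contDiff.comp b.contDiff
  · intro z hz
    show ((b z : ℝ) : ℂ) * extR (m + 1) c f z = _
    rw [b.one_of_mem_closedBall (by simpa using hz), extR_in hz]; simp
  · intro z hz
    show ((b z : ℝ) : ℂ) * extR (m + 1) c f z = _
    rw [b.zero_of_le_dist (by simpa using hz)]; simp

/-! ### Dyadic sums -/

lemma CH_zero_tsum {α : ℝ} (hα : 0 < α) (hα₁ : α < 1) {g : ℕ → ℂ → ℂ} {θ : ℝ}
    (hθ : θ = (1 / 2 : ℝ) ^ α)
    (h1 : ∀ R : ℝ, ∃ C : ℝ, 0 ≤ C ∧ ∀ j z, ‖z‖ ≤ R → ‖g j z‖ ≤ C * θ ^ j)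
    (h2 : ∀ R : ℝ, ∃ C : ℝ, 0 ≤ C ∧ ∀ j x y, ‖x‖ ≤ R → ‖y‖ ≤ R →
      ‖g j x - g j y‖ ≤ C * (2 * θ) ^ j * ‖x - y‖) :
    CH α Set.univ 0 (fun z => ∑' j, g j z) := by
  have hθ0 : 0 < θ := by rw [hθ]; positivity
  have hθ1 : θ < 1 := by rw [hθ]; exact Real.rpow_lt_one (by norm_num) (by norm_num) hα
  have hθ2 : 1 < 2 * θ := by
    have : (1 / 2 : ℝ) ^ (1 : ℝ) < (1 / 2 : ℝ) ^ α :=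
      Real.rpow_lt_rpow_of_exponent_gt (by norm_num) (by norm_num) hα₁
    rw [← hθ, Real.rpow_one] at this; linarith
  intro R
  obtain ⟨A, hA, hA'⟩ := h1 R
  obtain ⟨B, hB, hB'⟩ := h2 R
  have hgeo : Summable fun j : ℕ => θ ^ j := summable_geometric_of_lt_one hθ0.le hθ1
  have hp1 : 0 < 1 - θ := by linarith
  have hp2 : 0 < 2 * θ - 1 := by linarith
  refine ⟨(B / (2 * θ - 1) + 2 * A / (1 - θ)) / θ, by positivity, fun x _ y _ hx hy => ?_⟩
  have hsum : ∀ z : ℂ, ‖z‖ ≤ R → Summable fun j => g j z := fun z hz =>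
    Summable.of_norm_bounded (hgeo.mul_left A) fun j => hA' j z hz
  rcases (norm_nonneg (x - y)).eq_or_lt with h0 | h0
  · have : x = y := by rw [eq_comm, norm_eq_zero] at h0; exact sub_eq_zero.1 h0
    subst this; simp [Real.zero_rpow hα.ne']
  have hN : ∃ N : ℕ, (N = 0 ∨ ‖x - y‖ ≤ (1 / 2 : ℝ) ^ N) ∧ θ ^ N ≤ ‖x - y‖ ^ α / θ := by
    rcases le_total ‖x - y‖ 1 with hd | hd
    · obtain ⟨N, hN1, hN2⟩ := exists_nat_pow_near_of_lt_one h0 hd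
        (show (0 : ℝ) < 1 / 2 by norm_num) (by norm_num)
      refine ⟨N, Or.inr hN2, ?_⟩
      rw [le_div_iff₀ hθ0, ← pow_succ, hθ, ← Real.rpow_natCast, ← Real.rpow_mul (by norm_num),
        mul_comm, Real.rpow_mul (by norm_num), Real.rpow_natCast]
      exact Real.rpow_le_rpow (by positivity) hN1.le hα.le
    · refine ⟨0, Or.inl rfl, ?_⟩
      rw [pow_zero, le_div_iff₀ hθ0, one_mul]
      exact hθ1.le.trans (Real.one_le_rpow hd hα.le)
  obtain ⟨N, hN1, hN2⟩ := hN
  have hnb : ∀ j, ‖g j x - g j y‖ ≤ 2 * A * θ ^ j := fun j => by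
    have e1 := hA' j x hx
    have e2 := hA' j y hy
    have e3 := norm_sub_le (g j x) (g j y)
    linarith
  have hns : Summable fun j => ‖g j x - g j y‖ :=
    Summable.of_nonneg_of_le (fun _ => norm_nonneg _) hnb (hgeo.mul_left _)
  have hfin : ∑ j ∈ Finset.range N, ‖g j x - g j y‖ ≤ B / (2 * θ - 1) * θ ^ N := by
    rcases hN1 with rfl | hN1
    · simp; positivity
    calc ∑ j ∈ Finset.range N, ‖g j x - g j y‖
        ≤ ∑ j ∈ Finset.range N, B * ‖x - y‖ * (2 * θ) ^ j :=
          Finset.sum_le_sum fun j _ => by have := hB' j x y hx hy; linarith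
      _ = B * ‖x - y‖ * (((2 * θ) ^ N - 1) / (2 * θ - 1)) := by
          rw [← Finset.mul_sum, geom_sum_eq hθ2.ne']
      _ ≤ B * (1 / 2 : ℝ) ^ N * ((2 * θ) ^ N / (2 * θ - 1)) := by
          gcongr
          · apply div_nonneg _ hp2.le
            have := one_le_pow₀ (n := N) hθ2.le
            linarith
          · linarith
      _ = B / (2 * θ - 1) * θ ^ N := by
          rw [mul_pow, div_pow, one_pow]; field_simp
  have htail : ∑' j, ‖g (j + N) x - g (j + N) y‖ ≤ 2 * A / (1 - θ) * θ ^ N := by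
    have hs := (hgeo.mul_left (2 * A * θ ^ N))
    have : ∑' j : ℕ, 2 * A * θ ^ N * θ ^ j = 2 * A / (1 - θ) * θ ^ N := by
      rw [tsum_mul_left, tsum_geometric_of_lt_one hθ0.le hθ1]; field_simp
    rw [← this]
    refine Summable.tsum_le_tsum (fun j => ?_) ((summable_nat_add_iff N).2 hns) hs
    have := hnb (j + N)
    rw [pow_add] at this; linarith
  show ‖∑' j, g j x - ∑' j, g j y‖ ≤ _
  rw [← (hsum x hx).tsum_sub (hsum y hy)]
  calc ‖∑' j, (g j x - g j y)‖ ≤ ∑' j, ‖g j x - g j y‖ := norm_tsum_le_tsum_norm hns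
    _ = ∑ j ∈ Finset.range N, ‖g j x - g j y‖ + ∑' j, ‖g (j + N) x - g (j + N) y‖ :=
        (hns.sum_add_tsum_nat_add N).symm
    _ ≤ (B / (2 * θ - 1) + 2 * A / (1 - θ)) * θ ^ N := by rw [add_mul]; linarith
    _ ≤ (B / (2 * θ - 1) + 2 * A / (1 - θ)) * (‖x - y‖ ^ α / θ) := by gcongr
    _ = _ := by ring

/-! ### Test functions and convolution -/

/-- smooth functions supported in the disc of radius 8 -/
def TF (g : ℂ → ℂ) : Prop := ContDiff ℝ (⊤ : ℕ∞) g ∧ ∀ w, 8 < ‖w‖ → g w = 0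

/-- measurable locally bounded functions -/
def LB (f : ℂ → ℂ) : Prop := Measurable f ∧ ∀ R : ℝ, ∃ C : ℝ, 0 ≤ C ∧ ∀ z, ‖z‖ ≤ R → ‖f z‖ ≤ C

/-- convolution -/
noncomputable def J0 (g f : ℂ → ℂ) (z : ℂ) : ℂ := ∫ w, f (z - w) * g w

lemma TF.supp {g : ℂ → ℂ} (hg : TF g) : HasCompactSupport g := by
  refine HasCompactSupport.of_support_subset_isCompact (isCompact_closedBall (0 : ℂ) 8) ?_
  intro w hw
  by_contra h
  exact hw (hg.2 w (by simpa using h))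

lemma TF.cont {g : ℂ → ℂ} (hg : TF g) : Continuous g := hg.1.continuous

lemma TF.integrable {g : ℂ → ℂ} (hg : TF g) : Integrable g :=
  hg.cont.integrable_of_hasCompactSupport hg.supp

lemma TF.fderiv_zero {g : ℂ → ℂ} (hg : TF g) {w : ℂ} (hw : 8 < ‖w‖) : fderiv ℝ g w = 0 := by
  have : g =ᶠ[nhds w] fun _ => 0 := by
    filter_upwards [(isOpen_lt continuous_const continuous_norm).mem_nhds hw] with x hx
    exact hg.2 x hx
  rw [this.fderiv_eq]; simp

lemma TF.wz {g : ℂ → ℂ} (hg : TF g) : TF (wirtingerZ g) :=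
  ⟨contDiff_wirtingerZ hg.1, fun w hw => by simp [wirtingerZ, hg.fderiv_zero hw]⟩

lemma TF.wzb {g : ℂ → ℂ} (hg : TF g) : TF (wirtingerZbar g) :=
  ⟨contDiff_wirtingerZbar hg.1, fun w hw => by simp [wirtingerZbar, hg.fderiv_zero hw]⟩

lemma LB.locInt {f : ℂ → ℂ} (hf : LB f) : LocallyIntegrable f := by
  rw [locallyIntegrable_iff]
  intro k hk
  obtain ⟨R, hR⟩ := hk.isBounded.exists_norm_le
  obtain ⟨C, hC, h⟩ := hf.2 R
  refine Measure.integrableOn_of_bounded (M := C) hk.measure_ne_top hf.1.aestronglyMeasurable ?_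
  filter_upwards [ae_restrict_mem hk.measurableSet] with x hx
  exact h x (hR x hx)

lemma LB.scale {f : ℂ → ℂ} (hf : LB f) (c : ℝ) : LB (fun w => f (c * w)) := by
  refine ⟨hf.1.comp (by fun_prop), fun R => ?_⟩
  obtain ⟨C, hC, h⟩ := hf.2 (|c| * R)
  refine ⟨C, hC, fun z hz => h _ ?_⟩
  rw [norm_mul, Complex.norm_real, Real.norm_eq_abs]; gcongr

lemma LB_one : LB (fun _ => 1) := ⟨measurable_const, fun _ => ⟨1, zero_le_one, by simp⟩⟩

lemma J0_eq_conv (g f : ℂ → ℂ) :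
    J0 g f = convolution f g (ContinuousLinearMap.mul ℝ ℂ) volume := by
  ext z
  rw [convolution_def, J0, ← integral_sub_left_eq_self _ volume z]
  simp

lemma J0_deriv {g f : ℂ → ℂ} (hg : TF g) (hf : LB f) (z : ℂ) :
    HasFDerivAt (J0 g f) (WL (J0 (wirtingerZ g) f z) (J0 (wirtingerZbar g) f z)) z := by
  have h := hg.supp.hasFDerivAt_convolution_right (ContinuousLinearMap.mul ℝ ℂ) (μ := volume)
    hf.locInt (hg.1.of_le (by simp)) z
  rw [← J0_eq_conv] at h
  have hc : Continuous (fderiv ℝ g) := hg.1.continuous_fderiv (by simp)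
  have hcs : HasCompactSupport (fderiv ℝ g) := hg.supp.fderiv ℝ
  have key : ∀ v : ℂ, (convolution f (fderiv ℝ g)
      (ContinuousLinearMap.precompR ℂ (ContinuousLinearMap.mul ℝ ℂ)) volume) z v
      = J0 (fun a => fderiv ℝ g a v) f z := by
    intro v
    rw [convolution_precompR_apply _ hf.locInt hcs hc, J0_eq_conv]
  have hInt : ∀ v : ℂ, Integrable fun w => f (z - w) * fderiv ℝ g w v := by
    intro v
    have h2 : HasCompactSupport (fun a => fderiv ℝ g a v) :=
      HasCompactSupport.comp_left (g := fun L : ℂ →L[ℝ] ℂ => L v) hcs (by simp)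
    have := (h2.convolutionExists_right (ContinuousLinearMap.mul ℝ ℂ) hf.locInt
      (hc.clm_apply continuous_const) z).integrable_swap
    simpa using this
  refine h.congr_fderiv ?_
  rw [WL_surj (convolution f (fderiv ℝ g) _ volume z)]
  rw [key, key]
  congr 1
  · simp only [J0, wirtingerZ, smul_eq_mul]
    rw [← integral_const_mul, ← integral_sub (hInt 1) ((hInt I).const_mul I), ← integral_const_mul]
    congr 1; ext w; ring
  · simp only [J0, wirtingerZbar, smul_eq_mul]
    rw [← integral_const_mul, ← integral_add (hInt 1) ((hInt I).const_mul I), ← integral_const_mul]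
    congr 1; ext w; ring

lemma TF.int_deriv {g : ℂ → ℂ} (hg : TF g) :
    ∫ w, wirtingerZ g w = 0 ∧ ∫ w, wirtingerZbar g w = 0 := by
  have h := J0_deriv hg LB_one 0
  have h2 : J0 g (fun _ => 1) = fun _ => ∫ w, g w := by ext z; simp [J0]
  rw [h2] at h
  have h3 := h.unique (hasFDerivAt_const _ _)
  have e1 := WL_fst (J0 (wirtingerZ g) (fun _ => 1) 0) (J0 (wirtingerZbar g) (fun _ => 1) 0)
  have e2 := WL_snd (J0 (wirtingerZ g) (fun _ => 1) 0) (J0 (wirtingerZbar g) (fun _ => 1) 0)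
  rw [h3] at e1 e2
  simp [J0] at e1 e2
  exact ⟨e1.symm, e2.symm⟩

/-- scaled convolution -/
noncomputable def JJ (g f : ℂ → ℂ) (j : ℕ) (z : ℂ) : ℂ := ∫ w, f (z - ((1 / 2) ^ j : ℝ) * w) * g w

lemma JJ_eq (g f : ℂ → ℂ) (j : ℕ) :
    JJ g f j = fun z => J0 g (fun w => f (((1 / 2) ^ j : ℝ) * w)) ((2 ^ j : ℝ) * z) := by
  ext z
  simp only [JJ, J0]
  congr 1; ext w
  congr 2
  rw [mul_sub, ← mul_assoc, ← Complex.ofReal_mul, ← mul_pow]; norm_num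

lemma JJ_zero (g f : ℂ → ℂ) : JJ g f 0 = J0 g f := by rw [JJ_eq]; ext z; simp

lemma JJ_deriv {g f : ℂ → ℂ} (hg : TF g) (hf : LB f) (j : ℕ) (z : ℂ) :
    HasFDerivAt (JJ g f j) (WL ((2 ^ j : ℝ) * JJ (wirtingerZ g) f j z)
      ((2 ^ j : ℝ) * JJ (wirtingerZbar g) f j z)) z := by
  rw [JJ_eq, JJ_eq, JJ_eq]
  have h := J0_deriv hg (hf.scale ((1 / 2) ^ j)) ((2 ^ j : ℝ) * z)
  have h2 : HasFDerivAt (fun z : ℂ => ((2 ^ j : ℝ) : ℂ) * z)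
      (ContinuousLinearMap.mul ℝ ℂ ((2 ^ j : ℝ) : ℂ)) z :=
    (ContinuousLinearMap.mul ℝ ℂ ((2 ^ j : ℝ) : ℂ)).hasFDerivAt
  refine (h.comp z h2).congr_fderiv ?_
  ext v
  simp only [ContinuousLinearMap.comp_apply, ContinuousLinearMap.mul_apply', WL_apply, map_mul,
    Complex.conj_ofReal]
  ring

lemma half_pow_mem (j : ℕ) : 0 ≤ (1 / 2 : ℝ) ^ j ∧ (1 / 2 : ℝ) ^ j ≤ 1 :=
  ⟨by positivity, pow_le_one₀ (by norm_num) (by norm_num)⟩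

lemma arg_le {R : ℝ} {z w : ℂ} (j : ℕ) (hz : ‖z‖ ≤ R) (hw : ‖w‖ ≤ 8) :
    ‖z - ((1 / 2) ^ j : ℝ) * w‖ ≤ R + 8 := by
  have h1 := norm_sub_le z (((1 / 2) ^ j : ℝ) * w)
  rw [norm_mul, Complex.norm_real, Real.norm_eq_abs, abs_of_nonneg (half_pow_mem j).1] at h1
  have := mul_le_mul (half_pow_mem j).2 hw (norm_nonneg _) zero_le_one
  linarith

lemma JJ_bound {g f : ℂ → ℂ} (hg : TF g) (hf : LB f) (R : ℝ) :
    ∃ C : ℝ, 0 ≤ C ∧ ∀ j z, ‖z‖ ≤ R → ‖JJ g f j z‖ ≤ C := by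
  obtain ⟨C, hC, h⟩ := hf.2 (R + 8)
  refine ⟨∫ w, C * ‖g w‖, integral_nonneg fun w => by positivity, fun j z hz => ?_⟩
  refine norm_integral_le_of_norm_le (hg.integrable.norm.const_mul C) (ae_of_all _ fun w => ?_)
  rw [norm_mul]
  rcases le_or_gt ‖w‖ 8 with hw | hw
  · gcongr; exact h _ (arg_le j hz hw)
  · simp [hg.2 w hw]

lemma JJ_int {g f : ℂ → ℂ} (hg : TF g) (hf : LB f) (j : ℕ) (z : ℂ) :
    Integrable fun w => f (z - ((1 / 2) ^ j : ℝ) * w) * g w := by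
  obtain ⟨C, hC, h⟩ := hf.2 (‖z‖ + 8)
  refine (hg.integrable.norm.const_mul C).mono' ?_ (ae_of_all _ fun w => ?_)
  · exact ((hf.1.comp (by fun_prop)).mul hg.cont.measurable).aestronglyMeasurable
  rw [norm_mul]
  rcases le_or_gt ‖w‖ 8 with hw | hw
  · gcongr; exact h _ (arg_le j le_rfl hw)
  · simp [hg.2 w hw]

lemma JJ_diff {α : ℝ} (hα : 0 < α) {g f : ℂ → ℂ} (hg : TF g) (hf : LB f)
    (hf0 : CH α Set.univ 0 f) (R : ℝ) :
    ∃ C : ℝ, 0 ≤ C ∧ ∀ j z, ‖z‖ ≤ R →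
      ‖JJ g f j z - f z * ∫ w, g w‖ ≤ C * ((1 / 2 : ℝ) ^ α) ^ j := by
  obtain ⟨C, hC, h⟩ := hf0 (R + 8)
  refine ⟨∫ w, (C * 8 ^ α) * ‖g w‖, integral_nonneg fun w => by positivity, fun j z hz => ?_⟩
  rw [JJ, ← integral_const_mul, ← integral_sub (JJ_int hg hf j z) (hg.integrable.const_mul _),
    ← integral_mul_const]
  refine norm_integral_le_of_norm_le ((hg.integrable.norm.const_mul _).mul_const _)
    (ae_of_all _ fun w => ?_)
  rw [← sub_mul, norm_mul]
  rcases le_or_gt ‖w‖ 8 with hw | hw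
  · have h1 := h (z - ((1 / 2) ^ j : ℝ) * w) trivial z trivial (arg_le j hz hw) (by linarith)
    have h2 : ‖z - ((1 / 2) ^ j : ℝ) * w - z‖ = (1 / 2) ^ j * ‖w‖ := by
      rw [sub_sub_cancel_left, norm_neg, norm_mul, Complex.norm_real, Real.norm_eq_abs,
        abs_of_nonneg (half_pow_mem j).1]
    rw [h2, Real.mul_rpow (half_pow_mem j).1 (norm_nonneg _)] at h1
    have h3 : ((1 / 2 : ℝ) ^ j) ^ α = ((1 / 2 : ℝ) ^ α) ^ j := by
      rw [← Real.rpow_natCast, ← Real.rpow_mul (by norm_num), mul_comm,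
        Real.rpow_mul (by norm_num), Real.rpow_natCast]
    rw [h3] at h1
    have h4 : ‖w‖ ^ α ≤ 8 ^ α := Real.rpow_le_rpow (norm_nonneg _) hw hα.le
    calc _ ≤ C * (((1 / 2 : ℝ) ^ α) ^ j * ‖w‖ ^ α) * ‖g w‖ := by gcongr
      _ ≤ C * (((1 / 2 : ℝ) ^ α) ^ j * 8 ^ α) * ‖g w‖ := by gcongr
      _ = _ := by ring
  · simp [hg.2 w hw]

/-! ### The kernels -/

/-- cutoff -/
noncomputable def cutf (t : ℝ) : ℝ := Real.smoothTransition ((64 - t) / 48)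

lemma cutf_smooth : ContDiff ℝ (⊤ : ℕ∞) cutf :=
  Real.smoothTransition.contDiff.comp (by fun_prop)

lemma cutf_one {t : ℝ} (ht : t ≤ 16) : cutf t = 1 :=
  Real.smoothTransition.one_of_one_le (by linarith)

lemma cutf_zero {t : ℝ} (ht : 64 ≤ t) : cutf t = 0 :=
  Real.smoothTransition.zero_of_nonpos (by linarith)

lemma cutf_mem (t : ℝ) : 0 ≤ cutf t ∧ cutf t ≤ 1 :=
  ⟨Real.smoothTransition.nonneg _, Real.smoothTransition.le_one _⟩

lemma deriv_cutf_zero {t : ℝ} (ht : t < 16 ∨ 64 < t) : deriv cutf t = 0 := by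
  rcases ht with ht | ht
  · have : cutf =ᶠ[nhds t] fun _ => 1 := by
      filter_upwards [Iio_mem_nhds ht] with x hx using cutf_one (le_of_lt hx)
    rw [this.deriv_eq]; simp
  · have : cutf =ᶠ[nhds t] fun _ => 0 := by
      filter_upwards [Ioi_mem_nhds ht] with x hx using cutf_zero (le_of_lt hx)
    rw [this.deriv_eq]; simp

/-- cutoff on the plane -/
noncomputable def Lam (w : ℂ) : ℂ := (cutf (Complex.normSq w) : ℂ)

/-- derivative of the cutoff -/
noncomputable def rho (w : ℂ) : ℂ := ((deriv cutf (Complex.normSq w) / π : ℝ) : ℂ)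

/-- dyadic piece of the Cauchy kernel -/
noncomputable def kap (w : ℂ) : ℂ := (Lam w - Lam (2 * w)) * ((π : ℂ)⁻¹ * w⁻¹)

lemma contDiff_normSq' : ContDiff ℝ (⊤ : ℕ∞) (fun w : ℂ => Complex.normSq w) := by
  have : (fun w : ℂ => Complex.normSq w) = fun w : ℂ => w.re * w.re + w.im * w.im := by
    ext w; exact Complex.normSq_apply w
  rw [this]
  exact ((Complex.reCLM.contDiff).mul (Complex.reCLM.contDiff)).add
    ((Complex.imCLM.contDiff).mul (Complex.imCLM.contDiff))

lemma Lam_smooth : ContDiff ℝ (⊤ : ℕ∞) Lam :=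
  Complex.ofRealCLM.contDiff.comp (cutf_smooth.comp contDiff_normSq')

lemma Lam_zero {w : ℂ} (hw : 8 ≤ ‖w‖) : Lam w = 0 := by
  rw [Lam, cutf_zero]; simp
  rw [Complex.normSq_eq_norm_sq]; nlinarith

lemma Lam_one {w : ℂ} (hw : ‖w‖ ≤ 4) : Lam w = 1 := by
  rw [Lam, cutf_one]; simp
  rw [Complex.normSq_eq_norm_sq]; nlinarith [norm_nonneg w]

lemma Lam_norm (w : ℂ) : ‖Lam w‖ ≤ 1 := by
  rw [Lam, Complex.norm_real, Real.norm_eq_abs, abs_le]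
  have := cutf_mem (Complex.normSq w)
  constructor <;> linarith

lemma rho_zero {w : ℂ} (hw : ‖w‖ < 4) : rho w = 0 := by
  rw [rho, deriv_cutf_zero]; simp
  left; rw [Complex.normSq_eq_norm_sq]; nlinarith [norm_nonneg w]

lemma TF_rho : TF rho := by
  refine ⟨?_, fun w hw => ?_⟩
  · have h : ContDiff ℝ (⊤ : ℕ∞) (deriv cutf) := cutf_smooth.deriv'
    exact Complex.ofRealCLM.contDiff.comp ((h.comp contDiff_normSq').div_const π)
  · rw [rho, deriv_cutf_zero]; simp
    right; rw [Complex.normSq_eq_norm_sq]; nlinarith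

lemma TF_kap : TF kap := by
  refine ⟨?_, fun w hw => ?_⟩
  · rw [contDiff_iff_contDiffAt]
    intro z
    by_cases hz : z = 0
    · have : kap =ᶠ[nhds z] fun _ => 0 := by
        rw [hz]
        filter_upwards [Metric.closedBall_mem_nhds (0 : ℂ) (show (0 : ℝ) < 2 by norm_num)]
          with w hw
        have hw' : ‖w‖ ≤ 2 := by simpa using hw
        rw [kap, Lam_one (by linarith), Lam_one (by rw [norm_mul]; norm_num; linarith)]; simp
      exact contDiffAt_const.congr_of_eventuallyEq this
    · have h1 : ContDiff ℝ (⊤ : ℕ∞) (fun w => Lam w - Lam (2 * w)) :=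
        Lam_smooth.sub (Lam_smooth.comp (contDiff_const.mul contDiff_id))
      exact h1.contDiffAt.mul (contDiffAt_const.mul (contDiffAt_inv ℝ hz))
  · rw [kap, Lam_zero hw.le, Lam_zero (by rw [norm_mul]; norm_num; linarith)]; simp

lemma Lam_deriv (z : ℂ) (s : Set ℂ) : HasFDerivWithinAt Lam
    (WL (((deriv cutf (Complex.normSq z) : ℝ) : ℂ) * (starRingEnd ℂ) z)
      (((deriv cutf (Complex.normSq z) : ℝ) : ℂ) * z)) s z := by
  have h1 : HasFDerivAt (fun w : ℂ => Complex.normSq w)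
      (z.re • Complex.reCLM + z.re • Complex.reCLM + (z.im • Complex.imCLM + z.im • Complex.imCLM))
      z := by
    have : (fun w : ℂ => Complex.normSq w) = fun w : ℂ => w.re * w.re + w.im * w.im := by
      ext w; exact Complex.normSq_apply w
    rw [this]
    exact (Complex.reCLM.hasFDerivAt.mul Complex.reCLM.hasFDerivAt).add
      (Complex.imCLM.hasFDerivAt.mul Complex.imCLM.hasFDerivAt)
  have h2 : HasDerivAt cutf (deriv cutf (Complex.normSq z)) (Complex.normSq z) :=
    (cutf_smooth.differentiable (by simp) _).hasDerivAt
  have h3 := Complex.ofRealCLM.hasFDerivAt.comp z (h2.comp_hasFDerivAt z h1)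
  refine (show HasFDerivAt Lam _ z from h3).hasFDerivWithinAt.congr_fderiv ?_
  ext v
  apply Complex.ext
  · simp [WL_apply]; ring
  · simp [WL_apply]; ring

lemma kap_zbar (w : ℂ) : wirtingerZbar kap w = rho w - 4 * rho (2 * w) := by
  by_cases hz : w = 0
  · have h : kap =ᶠ[nhds w] fun _ => 0 := by
      rw [hz]
      filter_upwards [Metric.closedBall_mem_nhds (0 : ℂ) (show (0 : ℝ) < 2 by norm_num)]
        with w hw
      have hw' : ‖w‖ ≤ 2 := by simpa using hw
      rw [kap, Lam_one (by linarith), Lam_one (by rw [norm_mul]; norm_num; linarith)]; simp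
    rw [wirtingerZbar, h.fderiv_eq, hz, rho_zero (by simp), rho_zero (by simp)]; simp
  have hinv : HasFDerivWithinAt (fun z : ℂ => (π : ℂ)⁻¹ * z⁻¹) (WL ((π : ℂ)⁻¹ * -(w ^ 2)⁻¹) 0)
    Set.univ w := hw_of_hasDerivAt ((hasDerivAt_inv hz).const_mul _)
  have h2 : HasFDerivWithinAt (fun z : ℂ => 2 * z) (WL 2 0) Set.univ w :=
    hw_of_hasDerivAt (by simpa using (hasDerivAt_id w).const_mul 2)
  have h3 := hw_comp (Lam_deriv (2 * w) Set.univ) h2 (Set.mapsTo_univ _ _)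
  have h4 := hw_mul (hw_const (-1) Set.univ w) h3
  have h5 := hw_mul (hw_add (Lam_deriv w Set.univ) h4) hinv
  have h6 := hasFDerivWithinAt_univ.1 h5
  have h7 : (fun z => (Lam z + -1 * Lam (2 * z)) * ((π : ℂ)⁻¹ * z⁻¹)) = kap := by
    ext z; rw [kap]; ring
  rw [h7] at h6
  rw [(wirtinger_of_hasFDerivAt h6).2]
  simp only [rho]
  have hpi : (π : ℂ) ≠ 0 := by exact_mod_cast Real.pi_ne_zero
  have c2 : (starRingEnd ℂ) 2 = 2 := map_ofNat _ 2
  rw [c2]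
  push_cast
  field_simp
  ring

lemma rho_int : ∫ w, rho w = -1 := by
  have h1 : (∫ w, rho w) = ((∫ w : ℂ, deriv cutf (‖w‖ ^ 2) / π : ℝ) : ℂ) := by
    rw [← integral_complex_ofReal]
    congr 1; ext w; rw [rho, Complex.normSq_eq_norm_sq]
  rw [h1]
  have h2 := integral_fun_norm_addHaar (volume : Measure ℂ) (fun y : ℝ => deriv cutf (y ^ 2) / π)
  rw [h2]
  have hd : ∀ y : ℝ, HasDerivAt (fun y : ℝ => cutf (y ^ 2) / (2 * π))
      (y * (deriv cutf (y ^ 2) / π)) y := by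
    intro y
    have e1 : HasDerivAt cutf (deriv cutf (y ^ 2)) (y ^ 2) :=
      (cutf_smooth.differentiable (by simp) _).hasDerivAt
    have e2 := (HasDerivAt.comp (h := fun y : ℝ => y ^ 2) y e1 (hasDerivAt_pow 2 y)).div_const (2 * π)
    refine e2.congr_deriv ?_
    have := Real.pi_ne_zero
    simp; field_simp
  have h3 : ∫ y in Set.Ioi (0 : ℝ), y * (deriv cutf (y ^ 2) / π) = 0 - 1 / (2 * π) := by
    have hc : Continuous (deriv cutf) := cutf_smooth.continuous_deriv (by simp)
    rw [integral_Ioi_of_hasDerivAt_of_tendsto' (f := fun y : ℝ => cutf (y ^ 2) / (2 * π)) (m := 0)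
      (fun x _ => hd x)]
    · rw [cutf_one (by norm_num)]
    · apply Integrable.integrableOn
      apply Continuous.integrable_of_hasCompactSupport (by fun_prop)
      refine HasCompactSupport.of_support_subset_isCompact (isCompact_Icc (a := (-9 : ℝ)) (b := 9)) ?_
      intro y hy
      by_contra h
      apply hy
      show y * (deriv cutf (y ^ 2) / π) = 0
      rw [deriv_cutf_zero]; simp
      right
      simp only [Set.mem_Icc, not_and_or, not_le] at h
      rcases h with h | h <;> nlinarith
    · apply tendsto_const_nhds.congr'
      filter_upwards [Filter.eventually_ge_atTop (8 : ℝ)] with y hy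
      rw [cutf_zero (by nlinarith)]; simp
  have hb : (volume : Measure ℂ).real (Metric.ball 0 1) = π := by
    simp [Measure.real, Complex.volume_ball]
  rw [Complex.finrank_real_complex, hb]
  simp only [Nat.add_one_sub_one, pow_one, smul_eq_mul, nsmul_eq_mul]
  rw [h3]
  have : (2 : ℝ) * (π * (0 - 1 / (2 * π))) = -1 := by
    have := Real.pi_ne_zero
    field_simp; norm_num
  have h4 := congrArg (fun x : ℝ => (x : ℂ)) this
  push_cast at h4 ⊢
  exact h4

/-! ### The truncated Cauchy operator -/

/-- truncated Cauchy transform as a dyadic sum -/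
noncomputable def TT (f : ℂ → ℂ) (z : ℂ) : ℂ := ∑' j, ((1 / 2 : ℝ) ^ j : ℝ) * JJ kap f j z

lemma hasSum_WL {a b : ℕ → ℂ} {A B : ℂ} (ha : HasSum a A) (hb : HasSum b B) :
    HasSum (fun j => WL (a j) (b j)) (WL A B) := by
  have h1 := (ContinuousLinearMap.mul ℝ ℂ).hasSum ha
  have h2 := (((ContinuousLinearMap.compL ℝ ℂ ℂ ℂ).flip
    (Complex.conjCLE : ℂ →L[ℝ] ℂ)).comp (ContinuousLinearMap.mul ℝ ℂ)).hasSum hb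
  exact h1.add h2

lemma wl_deriv_tsum {F a b : ℕ → ℂ → ℂ} {r : ℝ} (hr0 : 0 ≤ r) (hr : r < 1)
    (hF : ∀ j z, HasFDerivAt (F j) (WL (a j z) (b j z)) z)
    (h0 : ∀ R : ℝ, ∃ C : ℝ, 0 ≤ C ∧ ∀ j z, ‖z‖ ≤ R → ‖F j z‖ ≤ C * r ^ j)
    (h1 : ∀ R : ℝ, ∃ C : ℝ, 0 ≤ C ∧ ∀ j z, ‖z‖ ≤ R → ‖a j z‖ ≤ C * r ^ j)
    (h2 : ∀ R : ℝ, ∃ C : ℝ, 0 ≤ C ∧ ∀ j z, ‖z‖ ≤ R → ‖b j z‖ ≤ C * r ^ j) (z : ℂ) :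
    HasFDerivAt (fun z => ∑' j, F j z) (WL (∑' j, a j z) (∑' j, b j z)) z := by
  have hgeo : Summable fun j : ℕ => r ^ j := summable_geometric_of_lt_one hr0 hr
  obtain ⟨C0, hC0, b0⟩ := h0 (‖z‖ + 1)
  obtain ⟨C1, hC1, b1⟩ := h1 (‖z‖ + 1)
  obtain ⟨C2, hC2, b2⟩ := h2 (‖z‖ + 1)
  have hz : z ∈ Metric.ball (0 : ℂ) (‖z‖ + 1) := by simp
  have hle : ∀ x ∈ Metric.ball (0 : ℂ) (‖z‖ + 1), ‖x‖ ≤ ‖z‖ + 1 := fun x hx => by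
    simpa using (Metric.mem_ball.1 hx).le
  have key := hasFDerivAt_tsum_of_isPreconnected (u := fun j => (C1 + C2) * r ^ j)
    (f := F) (f' := fun j x => WL (a j x) (b j x)) (hgeo.mul_left _) Metric.isOpen_ball
    (convex_ball (0 : ℂ) (‖z‖ + 1)).isPreconnected (fun j x _ => hF j x)
    (fun j x hx => (WL_norm_le _ _).trans (by
      have e1 := b1 j x (hle x hx)
      have e2 := b2 j x (hle x hx)
      linarith)) hz
    (Summable.of_norm_bounded (hgeo.mul_left C0) fun j => b0 j z (hle z hz)) hz
  refine key.congr_fderiv ?_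
  have s1 : Summable fun j => a j z :=
    Summable.of_norm_bounded (hgeo.mul_left C1) fun j => b1 j z (hle z hz)
  have s2 : Summable fun j => b j z :=
    Summable.of_norm_bounded (hgeo.mul_left C2) fun j => b2 j z (hle z hz)
  exact (hasSum_WL s1.hasSum s2.hasSum).tsum_eq

lemma lip_of_deriv {F a b : ℂ → ℂ} (hF : ∀ z, HasFDerivAt F (WL (a z) (b z)) z) {R C1 C2 : ℝ}
    (h1 : ∀ z, ‖z‖ ≤ R → ‖a z‖ ≤ C1) (h2 : ∀ z, ‖z‖ ≤ R → ‖b z‖ ≤ C2) {x y : ℂ}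
    (hx : ‖x‖ ≤ R) (hy : ‖y‖ ≤ R) : ‖F x - F y‖ ≤ (C1 + C2) * ‖x - y‖ := by
  refine (convex_closedBall (0 : ℂ) R).norm_image_sub_le_of_norm_hasFDerivWithin_le
    (fun z _ => (hF z).hasFDerivWithinAt) (fun z hz => ?_) (by simpa using hy) (by simpa using hx)
  have hz' : ‖z‖ ≤ R := by simpa using hz
  exact (WL_norm_le _ _).trans (add_le_add (h1 z hz') (h2 z hz'))


lemma theta_bds {α : ℝ} (hα : 0 < α) : 0 < (1 / 2 : ℝ) ^ α ∧ (1 / 2 : ℝ) ^ α < 1 :=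
  ⟨by positivity, Real.rpow_lt_one (by norm_num) (by norm_num) hα⟩


lemma theta_two {α : ℝ} (hα : 0 < α) (hα₁ : α < 1) : 1 / 2 ≤ (1 / 2 : ℝ) ^ α := by
  have : (1 / 2 : ℝ) ^ (1 : ℝ) < (1 / 2 : ℝ) ^ α :=
      Real.rpow_lt_rpow_of_exponent_gt (by norm_num) (by norm_num) hα₁
  rw [Real.rpow_one] at this; exact this.le

lemma term_bound {α : ℝ} (hα : 0 < α) (hα₁ : α < 1) {f : ℂ → ℂ} (hf : LB f) {g : ℂ → ℂ} (hg : TF g) (R : ℝ) :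
    ∃ C : ℝ, 0 ≤ C ∧ ∀ j z, ‖z‖ ≤ R →
      ‖((1 / 2 : ℝ) ^ j : ℝ) * JJ g f j z‖ ≤ C * ((1 / 2 : ℝ) ^ α) ^ j := by
  obtain ⟨C, hC, h⟩ := JJ_bound hg hf R
  refine ⟨C, hC, fun j z hz => ?_⟩
  rw [norm_mul, Complex.norm_real, Real.norm_eq_abs, abs_of_nonneg (half_pow_mem j).1, mul_comm]
  gcongr
  · exact h j z hz
  · exact theta_two hα hα₁

lemma term_deriv {α : ℝ} (hα : 0 < α) (hα₁ : α < 1) {f : ℂ → ℂ} (hf : LB f) {g : ℂ → ℂ} (hg : TF g) (j : ℕ) (z : ℂ) :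
    HasFDerivAt (fun z => ((1 / 2 : ℝ) ^ j : ℝ) * JJ g f j z)
      (WL (JJ (wirtingerZ g) f j z) (JJ (wirtingerZbar g) f j z)) z := by
  refine ((JJ_deriv hg hf j z).const_mul (((1 / 2 : ℝ) ^ j : ℝ) : ℂ)).congr_fderiv ?_
  ext v
  have : (((1 / 2 : ℝ) ^ j : ℝ) : ℂ) * ((2 ^ j : ℝ) : ℂ) = 1 := by
    rw [← Complex.ofReal_mul, ← mul_pow]; norm_num
  simp only [WL_apply, _root_.smul_apply, smul_eq_mul]
  linear_combination (JJ (wirtingerZ g) f j z * v +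
    JJ (wirtingerZbar g) f j z * (starRingEnd ℂ) v) * this

lemma TT_R0 {α : ℝ} (hα : 0 < α) (hα₁ : α < 1) {f : ℂ → ℂ} (hf : LB f) : CH α Set.univ 0 (TT f) := by
  obtain ⟨ht0, ht1⟩ := theta_bds hα
  have ht2 := theta_two hα hα₁
  refine CH_zero_tsum hα hα₁ rfl (term_bound hα hα₁ hf TF_kap) fun R => ?_
  obtain ⟨C1, hC1, b1⟩ := JJ_bound TF_kap.wz hf R
  obtain ⟨C2, hC2, b2⟩ := JJ_bound TF_kap.wzb hf R
  refine ⟨C1 + C2, by positivity, fun j x y hx hy => ?_⟩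
  refine (lip_of_deriv (term_deriv hα hα₁ hf TF_kap j) (b1 j) (b2 j) hx hy).trans ?_
  gcongr
  exact le_mul_of_one_le_right (by positivity) (one_le_pow₀ (by linarith))

lemma CH_JJ0 {α : ℝ} (hα : 0 < α) (hα₁ : α < 1) {f : ℂ → ℂ} (hf : LB f) : ∀ (m : ℕ) {g : ℂ → ℂ}, TF g → CH α Set.univ m (JJ g f 0)
  | 0, g, hg => by
      refine CH_zero_of_deriv hα₁ convex_univ
        (fun z _ => (JJ_deriv hg hf 0 z).hasFDerivWithinAt) fun R => ?_
      obtain ⟨C1, hC1, b1⟩ := JJ_bound hg.wz hf R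
      obtain ⟨C2, hC2, b2⟩ := JJ_bound hg.wzb hf R
      refine ⟨C1 + C2, by positivity, fun x _ hx => (WL_norm_le _ _).trans ?_⟩
      simpa using add_le_add (b1 0 x hx) (b2 0 x hx)
  | (m + 1), g, hg => by
      refine ⟨_, _, CH_JJ0 hα hα₁ hf m hg.wz, CH_JJ0 hα hα₁ hf m hg.wzb, fun z _ => ?_⟩
      simpa using JJ_deriv hg hf 0 z

lemma LB_of_CH {α : ℝ} (hα : 0 < α) {f : ℂ → ℂ} (hf : CH α Set.univ 0 f) : LB f :=
  ⟨(CH_continuous hα hf).measurable, fun R => by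
    obtain ⟨C, hC, h⟩ := CH_zero_bound hα hf R
    exact ⟨C, hC, fun z hz => h z trivial hz⟩⟩

lemma JJ_small {α : ℝ} (hα : 0 < α) {f : ℂ → ℂ} (hf : CH α Set.univ 0 f) {g : ℂ → ℂ} (hg : TF g) (hg0 : ∫ w, g w = 0)
    (R : ℝ) : ∃ C : ℝ, 0 ≤ C ∧ ∀ j z, ‖z‖ ≤ R → ‖JJ g f j z‖ ≤ C * ((1 / 2 : ℝ) ^ α) ^ j := by
  obtain ⟨C, hC, h⟩ := JJ_diff hα hg (LB_of_CH hα hf) hf R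
  refine ⟨C, hC, fun j z hz => ?_⟩
  simpa [hg0] using h j z hz

lemma JJ_kap_zbar {f : ℂ → ℂ} (hf : LB f) (j : ℕ) (z : ℂ) :
    JJ (wirtingerZbar kap) f j z = JJ rho f j z - JJ rho f (j + 1) z := by
  have h1 : JJ rho f (j + 1) z = ∫ w, f (z - ((1 / 2) ^ j : ℝ) * w) * (4 * rho (2 * w)) := by
    have h := Measure.integral_comp_smul (volume : Measure ℂ)
      (fun w : ℂ => f (z - ((1 / 2) ^ (j + 1) : ℝ) * w) * rho w) 2
    rw [Complex.finrank_real_complex] at h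
    have h' : JJ rho f (j + 1) z =
        4 * ∫ w : ℂ, f (z - ((1 / 2) ^ (j + 1) : ℝ) * ((2 : ℝ) • w)) * rho ((2 : ℝ) • w) := by
      rw [h, JJ]
      rw [show |((2 : ℝ) ^ 2)⁻¹| = 1 / 4 by rw [abs_of_nonneg] <;> norm_num]
      simp only [Complex.real_smul]
      rw [← mul_assoc]; norm_num
    rw [h', ← integral_const_mul]
    congr 1; ext w
    simp only [Complex.real_smul, pow_succ]
    push_cast
    ring_nf
  have hi1 := JJ_int TF_rho hf j z
  have hi2 : Integrable fun w => f (z - ((1 / 2) ^ j : ℝ) * w) * (4 * rho (2 * w)) := by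
    have := (JJ_int TF_kap.wzb hf j z)
    refine (hi1.sub this).congr (ae_of_all _ fun w => ?_)
    simp only [Pi.sub_apply, kap_zbar]; ring
  rw [h1, JJ, JJ, ← integral_sub hi1 hi2]
  congr 1; ext w; rw [kap_zbar]; ring

lemma TT_R1 {α : ℝ} (hα : 0 < α) (hα₁ : α < 1) {f : ℂ → ℂ} (hf : CH α Set.univ 0 f) : ∃ g1, CH α Set.univ 0 g1 ∧
    ∀ z, HasFDerivAt (TT f) (WL (g1 z) (f z + JJ rho f 0 z)) z := by
  obtain ⟨ht0, ht1⟩ := theta_bds hα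
  have ht2 := theta_two hα hα₁
  have hfL := LB_of_CH hα hf
  have s1 := JJ_small hα hf TF_kap.wz TF_kap.int_deriv.1
  have s2 := JJ_small hα hf TF_kap.wzb TF_kap.int_deriv.2
  refine ⟨fun z => ∑' j, JJ (wirtingerZ kap) f j z, ?_, fun z => ?_⟩
  · refine CH_zero_tsum hα hα₁ rfl s1 fun R => ?_
    obtain ⟨C1, hC1, b1⟩ := JJ_small hα hf TF_kap.wz.wz TF_kap.wz.int_deriv.1 R
    obtain ⟨C2, hC2, b2⟩ := JJ_small hα hf TF_kap.wz.wzb TF_kap.wz.int_deriv.2 R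
    refine ⟨C1 + C2, by positivity, fun j x y hx hy => ?_⟩
    refine (lip_of_deriv (C1 := C1 * (2 * (1 / 2 : ℝ) ^ α) ^ j)
      (C2 := C2 * (2 * (1 / 2 : ℝ) ^ α) ^ j) (JJ_deriv TF_kap.wz hfL j) (fun z hz => ?_)
      (fun z hz => ?_) hx hy).trans (by rw [← add_mul])
    · rw [norm_mul, Complex.norm_real, Real.norm_eq_abs, abs_of_nonneg (by positivity), mul_pow]
      have := mul_le_mul_of_nonneg_left (b1 j z hz) (show (0 : ℝ) ≤ 2 ^ j by positivity)
      linarith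
    · rw [norm_mul, Complex.norm_real, Real.norm_eq_abs, abs_of_nonneg (by positivity), mul_pow]
      have := mul_le_mul_of_nonneg_left (b2 j z hz) (show (0 : ℝ) ≤ 2 ^ j by positivity)
      linarith
  · have h := wl_deriv_tsum ht0.le ht1 (term_deriv hα hα₁ hfL TF_kap)
      (term_bound hα hα₁ hfL TF_kap) s1 s2 z
    have hs : ∑' j, JJ (wirtingerZbar kap) f j z = f z + JJ rho f 0 z := by
      obtain ⟨C, hC, b⟩ := s2 ‖z‖
      have hgeo : Summable fun j : ℕ => ((1 / 2 : ℝ) ^ α) ^ j :=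
        summable_geometric_of_lt_one ht0.le ht1
      have hsum : Summable fun j => JJ (wirtingerZbar kap) f j z :=
        Summable.of_norm_bounded (hgeo.mul_left C) fun j => b j z le_rfl
      refine tendsto_nhds_unique hsum.hasSum.tendsto_sum_nat ?_
      have e1 : ∀ N, ∑ j ∈ Finset.range N, JJ (wirtingerZbar kap) f j z
          = JJ rho f 0 z - JJ rho f N z := by
        intro N
        rw [Finset.sum_congr rfl fun j _ => JJ_kap_zbar hfL j z]
        exact Finset.sum_range_sub' (fun j => JJ rho f j z) N
      simp_rw [e1]
      have e2 : Filter.Tendsto (fun N => JJ rho f N z) Filter.atTop (nhds (-f z)) := by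
        obtain ⟨C, hC, b⟩ := JJ_diff hα TF_rho hfL hf ‖z‖
        rw [tendsto_iff_norm_sub_tendsto_zero]
        refine squeeze_zero (fun _ => norm_nonneg _) (fun j => ?_)
          (by simpa using hgeo.tendsto_atTop_zero.const_mul C)
        simpa [rho_int] using b j z le_rfl
      have := tendsto_const_nhds (x := JJ rho f 0 z) |>.sub e2
      rw [sub_neg_eq_add, add_comm] at this
      exact this
    rw [hs] at h
    exact h

lemma JJ_deriv_left {f f1 f2 : ℂ → ℂ} (hf : LB f) (h1 : LB f1) (h2 : LB f2)
    (h : ∀ z, HasFDerivAt f (WL (f1 z) (f2 z)) z) {g : ℂ → ℂ} (hg : TF g) (j : ℕ) (z : ℂ) :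
    HasFDerivAt (JJ g f j) (WL (JJ g f1 j z) (JJ g f2 j z)) z := by
  obtain ⟨C1, hC1, b1⟩ := h1.2 (‖z‖ + 1 + 8)
  obtain ⟨C2, hC2, b2⟩ := h2.2 (‖z‖ + 1 + 8)
  set c : ℂ := (((1 / 2) ^ j : ℝ) : ℂ) with hc
  have i1 : Integrable fun w => f1 (z - c * w) * g w := JJ_int hg h1 j z
  have i2 : Integrable fun w => f2 (z - c * w) * g w := JJ_int hg h2 j z
  have hWL : ∀ x w, WL (f1 (x - c * w) * g w) (f2 (x - c * w) * g w)
      = g w • WL (f1 (x - c * w)) (f2 (x - c * w)) := by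
    intro x w; ext v; simp [WL_apply]; ring
  have i3 : Integrable fun w => WL (f1 (z - c * w) * g w) (f2 (z - c * w) * g w) := by
    have e1 := (ContinuousLinearMap.mul ℝ ℂ).integrable_comp i1
    have e2 := (((ContinuousLinearMap.compL ℝ ℂ ℂ ℂ).flip
      (Complex.conjCLE : ℂ →L[ℝ] ℂ)).comp (ContinuousLinearMap.mul ℝ ℂ)).integrable_comp i2
    exact e1.add e2
  have key := hasFDerivAt_integral_of_dominated_of_fderiv_le (𝕜 := ℝ) (μ := volume)
    (F := fun z w => f (z - c * w) * g w)
    (F' := fun z w => WL (f1 (z - c * w) * g w) (f2 (z - c * w) * g w))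
    (x₀ := z) (bound := fun w => (C1 + C2) * ‖g w‖) (s := Metric.ball z 1)
    (Metric.ball_mem_nhds z one_pos)
    (Filter.Eventually.of_forall fun x => (JJ_int hg hf j x).aestronglyMeasurable)
    (JJ_int hg hf j z) i3.aestronglyMeasurable
    (ae_of_all _ fun w x hx => by
      have hx' : ‖x‖ ≤ ‖z‖ + 1 := by
        have e1 : ‖x - z‖ < 1 := by simpa [dist_eq_norm] using hx
        have e2 := norm_sub_norm_le x z
        linarith
      rw [hWL, norm_smul, mul_comm]
      rcases le_or_gt ‖w‖ 8 with hw | hw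
      · gcongr
        refine (WL_norm_le _ _).trans (add_le_add (b1 _ (arg_le j hx' hw)) (b2 _ (arg_le j hx' hw)))
      · simp [hg.2 w hw])
    (hg.integrable.norm.const_mul _)
    (ae_of_all _ fun w x hx => by
      have e1 : HasFDerivAt (fun x => x - c * w) (ContinuousLinearMap.id ℝ ℂ) x :=
        (hasFDerivAt_id x).sub_const _
      have e2 := ((h (x - c * w)).comp x e1).mul_const (g w)
      refine e2.congr_fderiv ?_
      rw [hWL]; rfl)
  refine (show HasFDerivAt (JJ g f j) _ z from key).congr_fderiv ?_
  ext v
  rw [ContinuousLinearMap.integral_apply i3]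
  simp only [WL_apply]
  rw [integral_add (i1.mul_const _) (i2.mul_const _), integral_mul_const, integral_mul_const]
  rfl

lemma TT_CH {α : ℝ} (hα : 0 < α) (hα₁ : α < 1) : ∀ (m : ℕ) {f : ℂ → ℂ}, CH α Set.univ m f → CH α Set.univ (m + 1) (TT f)
  | 0, f, hf => by
      obtain ⟨g1, hg1, h⟩ := TT_R1 hα hα₁ hf
      exact ⟨g1, _, hg1, CH_add 0 hf (CH_JJ0 hα hα₁ (LB_of_CH hα hf) 0 TF_rho),
        fun z _ => (h z).hasFDerivWithinAt⟩
  | (m + 1), f, hf => by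
      have hf0 := LB_of_CH hα (CH_le hα hα₁ convex_univ (Nat.zero_le _) hf)
      obtain ⟨f1, f2, h1, h2, h⟩ := hf
      obtain ⟨ht0, ht1⟩ := theta_bds hα
      have h10 := LB_of_CH hα (CH_le hα hα₁ convex_univ (Nat.zero_le _) h1)
      have h20 := LB_of_CH hα (CH_le hα hα₁ convex_univ (Nat.zero_le _) h2)
      refine ⟨TT f1, TT f2, TT_CH hα hα₁ m h1, TT_CH hα hα₁ m h2, fun z _ => HasFDerivAt.hasFDerivWithinAt ?_⟩
      refine wl_deriv_tsum ht0.le ht1 (fun j z => ?_) (term_bound hα hα₁ hf0 TF_kap)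
        (term_bound hα hα₁ h10 TF_kap) (term_bound hα hα₁ h20 TF_kap) z
      have e := JJ_deriv_left hf0 h10 h20 (fun z => by simpa using h z trivial) TF_kap j z
      refine (e.const_mul (((1 / 2 : ℝ) ^ j : ℝ) : ℂ)).congr_fderiv ?_
      ext v; simp [WL_apply]; ring

/-! ### Integral representation on the disc of radius 2 -/

/-- integrable majorant -/
noncomputable def ik (w : ℂ) : ℝ := if ‖w‖ ≤ 4 then ‖w‖⁻¹ else 0

lemma ik_nonneg (w : ℂ) : 0 ≤ ik w := by unfold ik; split_ifs <;> positivity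

lemma ik_integrable : Integrable ik := by
  have h := integrable_fun_norm_addHaar (volume : Measure ℂ)
    (f := fun y : ℝ => if y ≤ 4 then y⁻¹ else 0)
  refine h.2 ?_
  rw [Complex.finrank_real_complex]
  have : IntegrableOn (fun _ : ℝ => (1 : ℝ)) (Set.Ioc 0 4) := by simp
  rw [← integrable_indicator_iff measurableSet_Ioc] at this
  refine this.integrableOn.congr_fun (fun y hy => ?_) measurableSet_Ioi
  have hy' : (0 : ℝ) < y := hy
  by_cases h4 : y ≤ 4
  · rw [Set.indicator_of_mem (Set.mem_Ioc.2 ⟨hy', h4⟩)]; simp [h4, hy'.ne']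
  · rw [Set.indicator_of_notMem (fun h => h4 (Set.mem_Ioc.1 h).2)]; simp [h4]

/-- bounded measurable, supported in the disc of radius 2 -/
def LS (f : ℂ → ℂ) : Prop := LB f ∧ ∀ z, 2 < ‖z‖ → f z = 0

lemma LS.bound {f : ℂ → ℂ} (hf : LS f) : ∃ C : ℝ, 0 ≤ C ∧ ∀ z, ‖f z‖ ≤ C := by
  obtain ⟨C, hC, h⟩ := hf.1.2 2
  refine ⟨C, hC, fun z => ?_⟩
  rcases le_or_gt ‖z‖ 2 with hz | hz
  · exact h z hz
  · rw [hf.2 z hz]; simpa using hC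

lemma LS.ker_bound {f : ℂ → ℂ} (hf : LS f) {z w : ℂ} (hz : ‖z‖ ≤ 2) {C : ℝ} (hC : 0 ≤ C)
    (h : ‖f (z - w)‖ ≤ C) : ‖f (z - w)‖ * ‖w‖⁻¹ ≤ C * ik w := by
  rcases le_or_gt ‖z - w‖ 2 with h1 | h1
  · have : ‖w‖ ≤ 4 := by
      have := norm_sub_le z (z - w)
      rw [sub_sub_cancel] at this; linarith
    rw [ik, if_pos this]; gcongr
  · rw [hf.2 _ h1]; simp; exact mul_nonneg hC (ik_nonneg w)

lemma LS.int_ker {f : ℂ → ℂ} (hf : LS f) {z : ℂ} (hz : ‖z‖ ≤ 2) :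
    Integrable fun w => f (z - w) * ((π : ℂ)⁻¹ * w⁻¹) := by
  obtain ⟨C, hC, h⟩ := hf.bound
  refine (ik_integrable.const_mul (C * π⁻¹)).mono' ?_ (ae_of_all _ fun w => ?_)
  · exact ((hf.1.1.comp (by fun_prop)).mul (by fun_prop)).aestronglyMeasurable
  · have := hf.ker_bound hz hC (h (z - w))
    have hpi := Real.pi_pos
    rw [norm_mul, norm_mul, norm_inv, norm_inv, Complex.norm_real, Real.norm_eq_abs,
      abs_of_pos hpi]
    calc _ = π⁻¹ * (‖f (z - w)‖ * ‖w‖⁻¹) := by ring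
      _ ≤ π⁻¹ * (C * ik w) := by gcongr
      _ = _ := by ring

lemma TT_term (f : ℂ → ℂ) (j : ℕ) (z : ℂ) :
    (((1 / 2 : ℝ) ^ j : ℝ) : ℂ) * JJ kap f j z = ∫ w, f (z - w) *
      ((Lam ((2 ^ j : ℝ) * w) - Lam ((2 ^ (j + 1) : ℝ) * w)) * ((π : ℂ)⁻¹ * w⁻¹)) := by
  have h := Measure.integral_comp_smul (volume : Measure ℂ)
      (fun w : ℂ => f (z - ((1 / 2) ^ j : ℝ) * w) * kap w) (2 ^ j)
  rw [Complex.finrank_real_complex, abs_of_nonneg (by positivity)] at h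
  have h2 : JJ kap f j z = ((((2 : ℝ) ^ j) ^ 2 : ℝ) : ℂ) *
      ∫ w : ℂ, f (z - ((1 / 2) ^ j : ℝ) * ((2 ^ j : ℝ) • w)) * kap ((2 ^ j : ℝ) • w) := by
    rw [h, JJ, Complex.real_smul, ← mul_assoc, ← Complex.ofReal_mul, mul_inv_cancel₀ (by positivity)]
    simp
  rw [h2, ← mul_assoc, ← integral_const_mul]
  congr 1; ext w
  have e0 : ((2 ^ j : ℝ) : ℂ) ≠ 0 := by simp
  have e1 : (((1 / 2 : ℝ) ^ j : ℝ) : ℂ) * ((2 ^ j : ℝ) : ℂ) = 1 := by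
    rw [← Complex.ofReal_mul, ← mul_pow]; norm_num
  have e2 : (((1 / 2 : ℝ) ^ j : ℝ) : ℂ) = ((2 ^ j : ℝ) : ℂ)⁻¹ := eq_inv_of_mul_eq_one_left e1
  have e3 : (2 : ℂ) * (((2 ^ j : ℝ) : ℂ) * w) = ((2 ^ (j + 1) : ℝ) : ℂ) * w := by
    rw [pow_succ]; push_cast; ring
  have e4 : (((1 / 2 : ℝ) ^ j : ℝ) : ℂ) * (((2 ^ j : ℝ) : ℂ) * w) = w := by
    rw [← mul_assoc, e1, one_mul]
  rw [Complex.real_smul, kap, e3, e4, e2, mul_inv, Complex.ofReal_pow ((2 : ℝ) ^ j) 2]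
  field_simp

lemma TT_repr {f : ℂ → ℂ} (hf : LS f) {z : ℂ} (hz : ‖z‖ ≤ 2) :
    TT f z = ∫ w, f (z - w) * ((π : ℂ)⁻¹ * w⁻¹) := by
  have hα : (0 : ℝ) < 1 / 2 := by norm_num
  have hα₁ : (1 / 2 : ℝ) < 1 := by norm_num
  obtain ⟨ht0, ht1⟩ := theta_bds hα
  obtain ⟨C, hC, b⟩ := term_bound hα hα₁ hf.1 TF_kap ‖z‖
  have hsum : Summable fun j => (((1 / 2 : ℝ) ^ j : ℝ) : ℂ) * JJ kap f j z :=
    Summable.of_norm_bounded ((summable_geometric_of_lt_one ht0.le ht1).mul_left C)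
      fun j => b j z le_rfl
  refine tendsto_nhds_unique hsum.hasSum.tendsto_sum_nat ?_
  have hmeas : Measurable fun w => f (z - w) * ((π : ℂ)⁻¹ * w⁻¹) :=
    (hf.1.1.comp (by fun_prop)).mul (by fun_prop)
  have hLm : ∀ c : ℝ, Measurable fun w : ℂ => Lam (c * w) := fun c =>
    (Lam_smooth.continuous.comp (by fun_prop : Continuous fun w : ℂ => (c : ℂ) * w)).measurable
  have hInt : ∀ c d : ℝ, Integrable fun w => f (z - w) *
      ((Lam (c * w) - Lam (d * w)) * ((π : ℂ)⁻¹ * w⁻¹)) := by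
    intro c d
    have e : (fun w => f (z - w) * ((Lam (c * w) - Lam (d * w)) * ((π : ℂ)⁻¹ * w⁻¹)))
      = fun w => (Lam (c * w) - Lam (d * w)) * (f (z - w) * ((π : ℂ)⁻¹ * w⁻¹)) := by
      ext w; ring
    rw [e]
    refine (hf.int_ker hz).bdd_mul (c := 2) ((hLm c).sub (hLm d)).aestronglyMeasurable
      (ae_of_all _ fun w => ?_)
    refine (norm_sub_le _ _).trans ?_
    have := Lam_norm (c * w)
    have := Lam_norm (d * w)
    linarith
  have hpart : ∀ N : ℕ, ∑ j ∈ Finset.range N, (((1 / 2 : ℝ) ^ j : ℝ) : ℂ) * JJ kap f j z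
      = ∫ w, f (z - w) * ((Lam ((1 : ℝ) * w) - Lam ((2 ^ N : ℝ) * w)) * ((π : ℂ)⁻¹ * w⁻¹)) := by
    intro N
    rw [Finset.sum_congr rfl fun j _ => TT_term f j z, ← integral_finsetSum _ fun j _ => hInt _ _]
    congr 1; ext w
    rw [← Finset.mul_sum, ← Finset.sum_mul,
      Finset.sum_range_sub' (fun j => Lam ((2 ^ j : ℝ) * w)) N]
    simp
  simp_rw [hpart]
  refine tendsto_integral_of_dominated_convergence
    (fun w => 2 * ‖f (z - w) * ((π : ℂ)⁻¹ * w⁻¹)‖) (fun N => (hInt _ _).aestronglyMeasurable)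
    ((hf.int_ker hz).norm.const_mul 2) (fun N => ae_of_all _ fun w => ?_) ?_
  · have h1 := Lam_norm ((1 : ℝ) * w)
    have h2 := Lam_norm ((2 ^ N : ℝ) * w)
    have h3 := norm_sub_le (Lam ((1 : ℝ) * w)) (Lam ((2 ^ N : ℝ) * w))
    rw [mul_left_comm, norm_mul]
    gcongr
    linarith
  · refine ae_of_all _ fun w => ?_
    by_cases hw : w = 0
    · simp [hw]
    rcases le_or_gt ‖z - w‖ 2 with h1 | h1
    · have h4 : ‖w‖ ≤ 4 := by
        have := norm_sub_le z (z - w)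
        rw [sub_sub_cancel] at this; linarith
      have hwp : 0 < ‖w‖ := norm_pos_iff.2 hw
      apply tendsto_const_nhds.congr'
      have hev : ∀ᶠ N : ℕ in Filter.atTop, 8 / ‖w‖ ≤ (2 : ℝ) ^ N :=
        (tendsto_pow_atTop_atTop_of_one_lt (by norm_num : (1 : ℝ) < 2)).eventually_ge_atTop _
      filter_upwards [hev] with N hN
      rw [Lam_zero (w := ((2 ^ N : ℝ) : ℂ) * w), Lam_one (w := ((1 : ℝ) : ℂ) * w)]
      · simp
      · simpa using h4
      · rw [norm_mul, Complex.norm_real, Real.norm_eq_abs, abs_of_nonneg (by positivity)]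
        rwa [div_le_iff₀ hwp] at hN
    · simp [hf.2 _ h1]

/-- the constant of the weighted estimate -/
noncomputable def cM (M : ℝ) : ℝ := ∫ w, π⁻¹ * (Real.exp (-(M * ‖w‖ ^ 2 / 2)) * ik w)

lemma cM_int {M : ℝ} (hM : 0 ≤ M) :
    Integrable fun w => π⁻¹ * (Real.exp (-(M * ‖w‖ ^ 2 / 2)) * ik w) := by
  refine Integrable.const_mul (ik_integrable.bdd_mul (c := 1) ?_ (ae_of_all _ fun w => ?_)) _
  · exact (by fun_prop : Continuous fun w : ℂ => Real.exp (-(M * ‖w‖ ^ 2 / 2))).aestronglyMeasurable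
  · rw [Real.norm_eq_abs, abs_of_pos (Real.exp_pos _)]
    apply Real.exp_le_one_iff.2
    have : 0 ≤ M * ‖w‖ ^ 2 / 2 := by positivity
    linarith

lemma cM_tendsto : Filter.Tendsto (fun N : ℕ => cM N) Filter.atTop (nhds 0) := by
  have h0 : (0 : ℝ) = ∫ _ : ℂ, (0 : ℝ) := by simp
  rw [h0]
  refine tendsto_integral_of_dominated_convergence (fun w => π⁻¹ * (1 * ik w))
    (fun N => (cM_int (Nat.cast_nonneg N)).aestronglyMeasurable)
    ((ik_integrable.const_mul 1).const_mul _) (fun N => ae_of_all _ fun w => ?_) ?_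
  · have hik := ik_nonneg w
    have hpi := Real.pi_pos
    rw [Real.norm_eq_abs, abs_of_nonneg (by positivity)]
    gcongr
    apply Real.exp_le_one_iff.2
    have : 0 ≤ (N : ℝ) * ‖w‖ ^ 2 / 2 := by positivity
    linarith
  · refine ae_of_all _ fun w => ?_
    by_cases hw : w = 0
    · simp [hw, ik]
    have hwp : 0 < ‖w‖ := norm_pos_iff.2 hw
    have e1 : Filter.Tendsto (fun N : ℕ => (N : ℝ) * (‖w‖ ^ 2 / 2)) Filter.atTop Filter.atTop :=
      tendsto_natCast_atTop_atTop.atTop_mul_const (by positivity)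
    have e2 := Real.tendsto_exp_neg_atTop_nhds_zero.comp e1
    have e3 := (e2.mul_const (ik w)).const_mul π⁻¹
    simp only [zero_mul, mul_zero] at e3
    refine e3.congr fun N => ?_
    simp only [Function.comp]
    rw [mul_div_assoc]

/-- the entire function `(e^s-1)/s` -/
noncomputable def phe : ℂ → ℂ := dslope Complex.exp 0

lemma phe_diff : Differentiable ℂ phe := by
  have := (Complex.differentiableOn_dslope (f := Complex.exp) (c := 0) (s := Set.univ)
    Filter.univ_mem).2 Complex.differentiable_exp.differentiableOn
  exact differentiableOn_univ.1 this

lemma phe_mul (s : ℂ) : s * phe s = Complex.exp s - 1 := by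
  have := sub_smul_dslope Complex.exp 0 s
  simpa [phe] using this

/-- holomorphic correction -/
noncomputable def HH (M : ℝ) (g : ℂ → ℂ) (z : ℂ) : ℂ :=
  ∫ ζ, g ζ * ((π : ℂ)⁻¹ * (M * (starRingEnd ℂ) ζ * phe (M * (starRingEnd ℂ) ζ * (z - ζ))))

/-- gauged Cauchy operator -/
noncomputable def SS (M : ℝ) (g : ℂ → ℂ) (z : ℂ) : ℂ := TT g z + HH M g z

lemma LS.integrable {g : ℂ → ℂ} (hg : LS g) : Integrable g := by
  have h := (hg.1.locInt.integrableOn_isCompact (isCompact_closedBall (0 : ℂ) 2))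
  refine (integrableOn_iff_integrable_of_support_subset ?_).1 h
  intro z hz
  by_contra h
  exact hz (hg.2 z (by simpa using h))

lemma LS.mul_cont {g : ℂ → ℂ} (hg : LS g) {p : ℂ → ℂ} (hp : Continuous p) :
    LS (fun z => g z * p z) := by
  refine ⟨⟨hg.1.1.mul hp.measurable, fun R => ?_⟩, fun z hz => by simp [hg.2 z hz]⟩
  obtain ⟨C, hC, h⟩ := hg.bound
  obtain ⟨D, hD⟩ := (isCompact_closedBall (0 : ℂ) R).exists_bound_of_continuousOn hp.continuousOn
  refine ⟨C * max D 0, by positivity, fun z hz => ?_⟩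
  rw [norm_mul]
  gcongr
  · exact h z
  · exact (hD z (by simpa using hz)).trans (le_max_left _ _)

lemma HH_diff (M : ℝ) {g : ℂ → ℂ} (hg : LS g) : Differentiable ℂ (HH M g) := by
  have hphe' : Continuous (deriv phe) :=
    (phe_diff.contDiff (n := 1)).continuous_deriv (by simp)
  have hphe : Continuous phe := phe_diff.continuous
  intro z
  let G : ℂ → ℂ → ℂ := fun z ζ => (π : ℂ)⁻¹ * (M * (starRingEnd ℂ) ζ *
    (deriv phe (M * (starRingEnd ℂ) ζ * (z - ζ)) * (M * (starRingEnd ℂ) ζ)))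
  have hcj : Continuous (starRingEnd ℂ) := Complex.continuous_conj
  have hG : Continuous fun p : ℂ × ℂ => G p.1 p.2 := by fun_prop
  obtain ⟨D, hD⟩ := ((isCompact_closedBall z 1).prod
    (isCompact_closedBall (0 : ℂ) 2)).exists_bound_of_continuousOn hG.continuousOn
  have hInt : ∀ p : ℂ → ℂ, Continuous p → Integrable fun ζ => g ζ * p ζ := fun p hp =>
    (hg.mul_cont hp).integrable
  have key := hasDerivAt_integral_of_dominated_loc_of_deriv_le (𝕜 := ℂ) (μ := volume)
    (F := fun z ζ => g ζ * ((π : ℂ)⁻¹ * (M * (starRingEnd ℂ) ζ *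
      phe (M * (starRingEnd ℂ) ζ * (z - ζ)))))
    (F' := fun z ζ => g ζ * G z ζ) (x₀ := z) (bound := fun ζ => ‖g ζ‖ * D)
    (s := Metric.ball z 1) (Metric.ball_mem_nhds z one_pos)
    (Filter.Eventually.of_forall fun x => (hInt _ (by fun_prop)).aestronglyMeasurable)
    (hInt _ (by fun_prop))
    (hInt _ (hG.comp (by fun_prop : Continuous fun ζ : ℂ => (z, ζ)))).aestronglyMeasurable
    (ae_of_all _ fun ζ x hx => by
      rw [norm_mul]
      rcases le_or_gt ‖ζ‖ 2 with h | h
      · gcongr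
        exact hD (x, ζ) ⟨Metric.ball_subset_closedBall hx, by simpa using h⟩
      · simp [hg.2 ζ h])
    (hg.integrable.norm.mul_const D)
    (ae_of_all _ fun ζ x hx => by
      have e1 : HasDerivAt (fun x : ℂ => M * (starRingEnd ℂ) ζ * (x - ζ))
          (M * (starRingEnd ℂ) ζ) x := by
        simpa using ((hasDerivAt_id x).sub_const ζ).const_mul ((M : ℂ) * (starRingEnd ℂ) ζ)
      have e2 := (phe_diff (M * (starRingEnd ℂ) ζ * (x - ζ))).hasDerivAt.comp x e1
      exact ((e2.const_mul _).const_mul _).const_mul _)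
  exact key.2.differentiableAt

lemma SS_repr {M : ℝ} {g : ℂ → ℂ} (hg : LS g) {z : ℂ} (hz : ‖z‖ ≤ 2) :
    (Integrable fun w => g (z - w) * ((π : ℂ)⁻¹ * w⁻¹ *
        Complex.exp (M * (starRingEnd ℂ) (z - w) * w))) ∧
    SS M g z = ∫ w, g (z - w) * ((π : ℂ)⁻¹ * w⁻¹ *
        Complex.exp (M * (starRingEnd ℂ) (z - w) * w)) := by
  have hcj : Continuous (starRingEnd ℂ) := Complex.continuous_conj
  have hphe : Continuous phe := phe_diff.continuous
  have hi : Integrable fun ζ => g ζ * ((π : ℂ)⁻¹ * (M * (starRingEnd ℂ) ζ *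
      phe (M * (starRingEnd ℂ) ζ * (z - ζ)))) := (hg.mul_cont (by fun_prop)).integrable
  have h1 : HH M g z = ∫ w, g (z - w) * ((π : ℂ)⁻¹ * (M * (starRingEnd ℂ) (z - w) *
      phe (M * (starRingEnd ℂ) (z - w) * w))) := by
    rw [HH, ← integral_sub_left_eq_self _ volume z]
    simp only [sub_sub_cancel]
  have h2 : Integrable fun w => g (z - w) * ((π : ℂ)⁻¹ * (M * (starRingEnd ℂ) (z - w) *
      phe (M * (starRingEnd ℂ) (z - w) * w))) := by
    have := hi.comp_sub_left z
    simpa only [sub_sub_cancel] using this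
  have hae : ∀ᵐ w : ℂ, g (z - w) * ((π : ℂ)⁻¹ * w⁻¹) + g (z - w) * ((π : ℂ)⁻¹ *
      (M * (starRingEnd ℂ) (z - w) * phe (M * (starRingEnd ℂ) (z - w) * w)))
      = g (z - w) * ((π : ℂ)⁻¹ * w⁻¹ * Complex.exp (M * (starRingEnd ℂ) (z - w) * w)) := by
    have : ∀ᵐ w : ℂ, w ≠ 0 := by simp [ae_iff]
    filter_upwards [this] with w hw
    have h3 := phe_mul (M * (starRingEnd ℂ) (z - w) * w)
    rw [show Complex.exp (M * (starRingEnd ℂ) (z - w) * w) =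
      1 + (M * (starRingEnd ℂ) (z - w) * w) * phe (M * (starRingEnd ℂ) (z - w) * w) by
        rw [h3]; ring]
    generalize phe (M * (starRingEnd ℂ) (z - w) * w) = P
    have hpi : (π : ℂ) ≠ 0 := by exact_mod_cast Real.pi_ne_zero
    field_simp
  refine ⟨((hg.int_ker hz).add h2).congr hae, ?_⟩
  rw [SS, TT_repr hg hz, h1, ← integral_add (hg.int_ker hz) h2]
  exact integral_congr_ae hae

/-- weight -/
noncomputable def EE (M : ℝ) (z : ℂ) : ℝ := Real.exp (M * ‖z‖ ^ 2 / 2)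

lemma gauge_norm (M : ℝ) (z w : ℂ) : ‖Complex.exp (M * (starRingEnd ℂ) (z - w) * w)‖ * EE M (z - w)
    = EE M z * Real.exp (-(M * ‖w‖ ^ 2 / 2)) := by
  rw [Complex.norm_exp, EE, EE, ← Real.exp_add, ← Real.exp_add]
  congr 1
  rw [← Complex.normSq_eq_norm_sq, ← Complex.normSq_eq_norm_sq, ← Complex.normSq_eq_norm_sq,
    Complex.normSq_apply, Complex.normSq_apply, Complex.normSq_apply]
  simp
  ring

lemma SS_bound {M : ℝ} (hM : 0 ≤ M) {g : ℂ → ℂ} (hg : LS g) {A : ℝ} (hA : 0 ≤ A)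
    (h : ∀ ζ, ‖g ζ‖ ≤ A * EE M ζ) {z : ℂ} (hz : ‖z‖ ≤ 2) :
    ‖SS M g z‖ ≤ A * EE M z * cM M := by
  rw [(SS_repr hg hz).2, cM, ← integral_const_mul]
  refine norm_integral_le_of_norm_le ((cM_int hM).const_mul _) (ae_of_all _ fun w => ?_)
  have hpi := Real.pi_pos
  have hE : ∀ z, 0 < EE M z := fun z => Real.exp_pos _
  have h1 := hg.ker_bound hz (mul_nonneg hA (hE (z - w)).le) (h (z - w))
  rw [norm_mul, norm_mul, norm_mul, norm_inv, norm_inv, Complex.norm_real, Real.norm_eq_abs,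
    abs_of_pos hpi]
  set X := ‖Complex.exp (M * (starRingEnd ℂ) (z - w) * w)‖ with hX
  have hg2 := gauge_norm M z w
  rw [← hX] at hg2
  calc ‖g (z - w)‖ * (π⁻¹ * ‖w‖⁻¹ * X) = π⁻¹ * X * (‖g (z - w)‖ * ‖w‖⁻¹) := by ring
    _ ≤ π⁻¹ * X * (A * EE M (z - w) * ik w) := by gcongr
    _ = π⁻¹ * A * ik w * (X * EE M (z - w)) := by ring
    _ = A * EE M z * (π⁻¹ * (Real.exp (-(M * ‖w‖ ^ 2 / 2)) * ik w)) := by rw [hg2]; ring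

lemma LS.sub {f g : ℂ → ℂ} (hf : LS f) (hg : LS g) : LS (fun z => f z - g z) := by
  refine ⟨⟨hf.1.1.sub hg.1.1, fun R => ?_⟩, fun z hz => by simp [hf.2 z hz, hg.2 z hz]⟩
  obtain ⟨C, hC, h⟩ := hf.bound
  obtain ⟨D, hD, h'⟩ := hg.bound
  exact ⟨C + D, by positivity, fun z _ => (norm_sub_le _ _).trans (add_le_add (h z) (h' z))⟩

lemma SS_sub {M : ℝ} {f g : ℂ → ℂ} (hf : LS f) (hg : LS g) {z : ℂ} (hz : ‖z‖ ≤ 2) :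
    SS M (fun z => f z - g z) z = SS M f z - SS M g z := by
  rw [(SS_repr (hf.sub hg) hz).2, (SS_repr hf hz).2, (SS_repr hg hz).2,
    ← integral_sub (SS_repr hf hz).1 (SS_repr hg hz).1]
  congr 1; ext w; ring

lemma SS_cont (M : ℝ) {f : ℂ → ℂ} (hf : LS f) : Continuous (SS M f) := by
  have hα : (0 : ℝ) < 1 / 2 := by norm_num
  exact (CH_continuous hα (TT_R0 hα (by norm_num) hf.1)).add (HH_diff M hf).continuous

lemma TT_pow {f : ℂ → ℂ} (hf : LS f) (j : ℕ) : ∃ c : ℕ → ℂ, ∀ z, ‖z‖ ≤ 2 →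
    z ^ j * TT f z = TT (fun ζ => f ζ * ζ ^ j) z + ∑ i ∈ Finset.range j, z ^ i * c i := by
  refine ⟨fun i => (π : ℂ)⁻¹ * ∫ ζ, f ζ * ζ ^ (j - 1 - i), fun z hz => ?_⟩
  have hfj : LS (fun ζ => f ζ * ζ ^ j) := hf.mul_cont (by fun_prop)
  have hi : ∀ i : ℕ, Integrable fun ζ => f ζ * ζ ^ i := fun i =>
    (hf.mul_cont (by fun_prop)).integrable
  have e1 : ∑ i ∈ Finset.range j, z ^ i * ((π : ℂ)⁻¹ * ∫ ζ, f ζ * ζ ^ (j - 1 - i))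
      = ∫ ζ, ∑ i ∈ Finset.range j, z ^ i * ((π : ℂ)⁻¹ * (f ζ * ζ ^ (j - 1 - i))) := by
    rw [integral_finsetSum _ fun i _ => ((hi _).const_mul _).const_mul _]
    refine Finset.sum_congr rfl fun i _ => ?_
    rw [integral_const_mul, integral_const_mul]
  have hI : Integrable fun ζ => ∑ i ∈ Finset.range j, z ^ i * ((π : ℂ)⁻¹ *
      (f ζ * ζ ^ (j - 1 - i))) :=
    integrable_finsetSum _ fun i _ => ((hi _).const_mul _).const_mul _
  rw [e1, ← integral_sub_left_eq_self _ volume z, TT_repr hf hz, TT_repr hfj hz,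
    ← integral_const_mul, ← integral_add (hfj.int_ker hz) (hI.comp_sub_left z)]
  have : ∀ᵐ w : ℂ, w ≠ 0 := by simp [ae_iff]
  refine integral_congr_ae ?_
  filter_upwards [this] with w hw
  have e2 : ∑ i ∈ Finset.range j, z ^ i * ((π : ℂ)⁻¹ * (f (z - w) * (z - w) ^ (j - 1 - i)))
    = (π : ℂ)⁻¹ * f (z - w) * ∑ i ∈ Finset.range j, z ^ i * (z - w) ^ (j - 1 - i) := by
    rw [Finset.mul_sum]; exact Finset.sum_congr rfl fun i _ => by ring
  have e3 := geom_sum₂_mul z (z - w) j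
  rw [sub_sub_cancel] at e3
  rw [e2, (eq_mul_inv_iff_mul_eq₀ hw).2 e3]
  ring

/-- right-hand side with twisted conjugate -/
noncomputable def FF {n : ℕ} (B1 B2 : Fin n → Fin n → ℂ → ℂ) (q : ℂ → ℂ) (v : ℂ → Fin n → ℂ)
    (i : Fin n) (ζ : ℂ) : ℂ :=
  ∑ l, (B1 i l ζ * v ζ l + B2 i l ζ * (q ζ * (starRingEnd ℂ) (v ζ l)))

lemma FF_sub {n : ℕ} (B1 B2 : Fin n → Fin n → ℂ → ℂ) (q : ℂ → ℂ) (v w : ℂ → Fin n → ℂ)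
    (i : Fin n) (ζ : ℂ) : FF B1 B2 q v i ζ - FF B1 B2 q w i ζ =
      FF B1 B2 q (fun z => v z - w z) i ζ := by
  simp only [FF, ← Finset.sum_sub_distrib]
  refine Finset.sum_congr rfl fun l _ => ?_
  simp only [Pi.sub_apply, map_sub]; ring

lemma FF_bound {n : ℕ} {B1 B2 : Fin n → Fin n → ℂ → ℂ} {q : ℂ → ℂ} {β : ℝ}
    (h1 : ∀ i l z, ‖B1 i l z‖ ≤ β) (h2 : ∀ i l z, ‖B2 i l z‖ ≤ β) (hq : ∀ z, ‖q z‖ ≤ 1)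
    (v : ℂ → Fin n → ℂ) (i : Fin n) (ζ : ℂ) : ‖FF B1 B2 q v i ζ‖ ≤ n * (2 * β) * ‖v ζ‖ := by
  have : ∀ l ∈ Finset.univ, ‖B1 i l ζ * v ζ l + B2 i l ζ * (q ζ * (starRingEnd ℂ) (v ζ l))‖ ≤
      2 * β * ‖v ζ‖ := fun l _ => by
    have hb : 0 ≤ β := (norm_nonneg _).trans (h1 i l ζ)
    have hv : ‖v ζ l‖ ≤ ‖v ζ‖ := norm_le_pi_norm _ _
    refine (norm_add_le _ _).trans ?_
    rw [norm_mul, norm_mul, norm_mul, RCLike.norm_conj]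
    have e1 : ‖B1 i l ζ‖ * ‖v ζ l‖ ≤ β * ‖v ζ‖ := by gcongr; exact h1 i l ζ
    have e2 : ‖B2 i l ζ‖ * (‖q ζ‖ * ‖v ζ l‖) ≤ β * (1 * ‖v ζ‖) := by
      gcongr
      · exact h2 i l ζ
      · exact hq ζ
    linarith
  refine (norm_sum_le_of_le _ this).trans (le_of_eq ?_)
  simp; ring

lemma bdd_of_supp {g : ℂ → ℂ} (hg : Continuous g) (h0 : ∀ z, 2 ≤ ‖z‖ → g z = 0) :
    ∃ C : ℝ, 0 ≤ C ∧ ∀ z, ‖g z‖ ≤ C := by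
  obtain ⟨D, hD⟩ := (isCompact_closedBall (0 : ℂ) 2).exists_bound_of_continuousOn hg.continuousOn
  refine ⟨max D 0, le_max_right _ _, fun z => ?_⟩
  rcases le_or_gt ‖z‖ 2 with h | h
  · exact (hD z (by simpa using h)).trans (le_max_left _ _)
  · rw [h0 z h.le]; simp

lemma FF_LS {n : ℕ} {B1 B2 : Fin n → Fin n → ℂ → ℂ} {q : ℂ → ℂ} {β : ℝ}
    (c1 : ∀ i l, Continuous (B1 i l)) (c2 : ∀ i l, Continuous (B2 i l))
    (z1 : ∀ i l z, 2 ≤ ‖z‖ → B1 i l z = 0) (z2 : ∀ i l z, 2 ≤ ‖z‖ → B2 i l z = 0) (hβ : 0 ≤ β)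
    (h1 : ∀ i l z, ‖B1 i l z‖ ≤ β) (h2 : ∀ i l z, ‖B2 i l z‖ ≤ β) (hq : ∀ z, ‖q z‖ ≤ 1)
    (hqm : Measurable q)
    {v : ℂ → Fin n → ℂ} (hv : Continuous v) (i : Fin n) : LS (FF B1 B2 q v i) := by
  refine ⟨⟨?_, fun R => ?_⟩, fun z hz => ?_⟩
  · unfold FF
    refine Finset.measurable_sum _ fun l _ => ?_
    have hvl : Continuous fun ζ => v ζ l := (continuous_apply l).comp hv
    exact ((c1 i l).measurable.mul hvl.measurable).add ((c2 i l).measurable.mul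
      (hqm.mul (Complex.continuous_conj.comp hvl).measurable))
  · obtain ⟨D, hD⟩ := (isCompact_closedBall (0 : ℂ) R).exists_bound_of_continuousOn hv.continuousOn
    refine ⟨n * (2 * β) * max D 0, by positivity, fun z hz => ?_⟩
    refine (FF_bound h1 h2 hq v i z).trans ?_
    gcongr
    exact (hD z (by simpa using hz)).trans (le_max_left _ _)
  · unfold FF
    refine Finset.sum_eq_zero fun l _ => ?_
    rw [z1 i l z hz.le, z2 i l z hz.le]; ring

/-- radial retraction on the disc of radius two -/
noncomputable def PP (z : ℂ) : ℂ := ((2 / max 2 ‖z‖ : ℝ) : ℂ) * z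

lemma PP_cont : Continuous PP := by
  unfold PP
  have : Continuous fun z : ℂ => (2 / max 2 ‖z‖ : ℝ) :=
    continuous_const.div (by fun_prop) fun z => by positivity
  fun_prop

lemma PP_le (z : ℂ) : ‖PP z‖ ≤ 2 := by
  unfold PP
  rw [norm_mul, Complex.norm_real, Real.norm_eq_abs, abs_of_pos (by positivity), div_mul_eq_mul_div,
    div_le_iff₀ (by positivity)]
  have := le_max_right 2 ‖z‖
  linarith

lemma PP_id {z : ℂ} (hz : ‖z‖ ≤ 2) : PP z = z := by
  unfold PP; rw [max_eq_left hz]; simp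

lemma EE_cont (M : ℝ) : Continuous (EE M) := by unfold EE; fun_prop
lemma EE_pos (M : ℝ) (z : ℂ) : 0 < EE M z := Real.exp_pos _
lemma EE_zero (M : ℝ) : EE M 0 = 1 := by simp [EE]
lemma EE_ge {M : ℝ} (hM : 0 ≤ M) (z : ℂ) : 1 ≤ EE M z := by
  unfold EE; exact Real.one_le_exp (by positivity)

lemma fixed_pt {n : ℕ} (B1 B2 : Fin n → Fin n → ℂ → ℂ) (q : ℂ → ℂ)
    (c1 : ∀ i l, Continuous (B1 i l)) (c2 : ∀ i l, Continuous (B2 i l))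
    (z1 : ∀ i l z, 2 ≤ ‖z‖ → B1 i l z = 0) (z2 : ∀ i l z, 2 ≤ ‖z‖ → B2 i l z = 0)
    (hq : ∀ z, ‖q z‖ ≤ 1) (hqm : Measurable q) (b : Fin n → ℂ) :
    ∃ (M : ℝ) (v : ℂ → Fin n → ℂ), Continuous v ∧ (∀ i, LS (FF B1 B2 q v i)) ∧
      ∀ z, ‖z‖ ≤ 2 → ∀ i, v z i =
        b i + SS M (FF B1 B2 q v i) z - SS M (FF B1 B2 q v i) 0 := by
  choose β1 hβ1 hb1 using fun i l => bdd_of_supp (c1 i l) (z1 i l)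
  choose β2 hβ2 hb2 using fun i l => bdd_of_supp (c2 i l) (z2 i l)
  obtain ⟨β, hβ, h1, h2⟩ : ∃ β : ℝ, 0 ≤ β ∧ (∀ i l z, ‖B1 i l z‖ ≤ β) ∧
      ∀ i l z, ‖B2 i l z‖ ≤ β := by
    refine ⟨∑ i, ∑ l, (β1 i l + β2 i l), Finset.sum_nonneg fun i _ => Finset.sum_nonneg fun l _ =>
      add_nonneg (hβ1 i l) (hβ2 i l), ?_, ?_⟩
    all_goals
      intro i l z
      have e1 : β1 i l + β2 i l ≤ ∑ l, (β1 i l + β2 i l) :=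
        Finset.single_le_sum (f := fun l => β1 i l + β2 i l)
          (fun l _ => add_nonneg (hβ1 i l) (hβ2 i l)) (Finset.mem_univ l)
      have e2 : ∑ l, (β1 i l + β2 i l) ≤ ∑ i, ∑ l, (β1 i l + β2 i l) :=
        Finset.single_le_sum (f := fun i => ∑ l, (β1 i l + β2 i l))
          (fun i _ => Finset.sum_nonneg fun l _ => add_nonneg (hβ1 i l) (hβ2 i l))
          (Finset.mem_univ i)
      have := hb1 i l z
      have := hb2 i l z
      have := hβ1 i l
      have := hβ2 i l
      linarith
  set K : ℝ := n * (2 * β) with hK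
  have hK0 : 0 ≤ K := by positivity
  obtain ⟨M, hM, hc⟩ : ∃ M : ℝ, 0 ≤ M ∧ 2 * K * cM M ≤ 1 / 2 := by
    have ht : Filter.Tendsto (fun N : ℕ => 2 * K * cM N) Filter.atTop (nhds (2 * K * 0)) :=
      cM_tendsto.const_mul _
    rw [mul_zero] at ht
    obtain ⟨N, hN⟩ := (ht.eventually (ge_mem_nhds (show (0 : ℝ) < 1 / 2 by norm_num))).exists
    exact ⟨N, Nat.cast_nonneg N, hN⟩
  let V : BoundedContinuousFunction ℂ (Fin n → ℂ) → ℂ → Fin n → ℂ :=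
    fun y z => (EE M z : ℂ) • y z
  have hV : ∀ y, Continuous (V y) := fun y =>
    (Complex.continuous_ofReal.comp (EE_cont M)).smul y.continuous
  have hLS : ∀ y i, LS (FF B1 B2 q (V y) i) := fun y i =>
    FF_LS c1 c2 z1 z2 hβ h1 h2 hq hqm (hV y) i
  let G : BoundedContinuousFunction ℂ (Fin n → ℂ) → ℂ → Fin n → ℂ := fun y z i =>
    (EE M z : ℂ)⁻¹ * (b i + SS M (FF B1 B2 q (V y) i) z - SS M (FF B1 B2 q (V y) i) 0)
  have hEne : ∀ z, (EE M z : ℂ) ≠ 0 := fun z => by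
    exact_mod_cast (EE_pos M z).ne'
  have hG : ∀ y, Continuous (G y) := fun y => by
    refine continuous_pi fun i => ?_
    have := SS_cont M (hLS y i)
    exact ((Complex.continuous_ofReal.comp (EE_cont M)).inv₀ hEne).mul
      ((continuous_const.add this).sub continuous_const)
  have hGb : ∀ y, ∃ C, ∀ z, ‖G y (PP z)‖ ≤ C := fun y => by
    obtain ⟨D, hD⟩ := (isCompact_closedBall (0 : ℂ) 2).exists_bound_of_continuousOn
      (hG y).continuousOn
    exact ⟨D, fun z => hD _ (by simpa using PP_le z)⟩
  choose C hC using hGb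
  let Φ : BoundedContinuousFunction ℂ (Fin n → ℂ) → BoundedContinuousFunction ℂ (Fin n → ℂ) :=
    fun y => BoundedContinuousFunction.ofNormedAddCommGroup (fun z => G y (PP z))
      ((hG y).comp PP_cont) (C y) (hC y)
  have hΦ : ∀ y z, Φ y z = G y (PP z) := fun y z => rfl
  have hcontr : ContractingWith (1 / 2) Φ := by
    refine ⟨by rw [← NNReal.coe_lt_coe]; norm_num, LipschitzWith.of_dist_le_mul fun y y' => ?_⟩
    rw [BoundedContinuousFunction.dist_le (by positivity)]
    intro z
    rw [dist_pi_le_iff (by positivity)]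
    intro i
    rw [hΦ, hΦ, dist_eq_norm]
    set A : ℝ := K * dist y y' with hA
    have hA0 : 0 ≤ A := by positivity
    have hL := (hLS y i).sub (hLS y' i)
    have hbd : ∀ ζ, ‖FF B1 B2 q (V y) i ζ - FF B1 B2 q (V y') i ζ‖ ≤ A * EE M ζ := fun ζ => by
      rw [FF_sub]
      refine (FF_bound h1 h2 hq _ i ζ).trans ?_
      rw [← hK, hA, mul_assoc K]
      refine mul_le_mul_of_nonneg_left ?_ hK0
      have : V y ζ - V y' ζ = (EE M ζ : ℂ) • (y ζ - y' ζ) := by simp [V, smul_sub]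
      rw [this, norm_smul, Complex.norm_real, Real.norm_eq_abs, abs_of_pos (EE_pos M ζ), mul_comm]
      gcongr
      · exact (EE_pos M ζ).le
      rw [← dist_eq_norm]; exact BoundedContinuousFunction.dist_coe_le_dist ζ
    have s1 := SS_bound hM hL hA0 hbd (PP_le z)
    have s0 := SS_bound hM hL hA0 hbd (z := 0) (by simp)
    rw [SS_sub (hLS y i) (hLS y' i) (PP_le z)] at s1
    rw [SS_sub (hLS y i) (hLS y' i) (by simp), EE_zero] at s0
    have hE := EE_ge hM (PP z)
    have hcM : 0 ≤ A * cM M := by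
      have := norm_nonneg _ |>.trans s0
      linarith
    have e : G y (PP z) i - G y' (PP z) i = (EE M (PP z) : ℂ)⁻¹ *
        ((SS M (FF B1 B2 q (V y) i) (PP z) - SS M (FF B1 B2 q (V y') i) (PP z)) -
        (SS M (FF B1 B2 q (V y) i) 0 - SS M (FF B1 B2 q (V y') i) 0)) := by
      simp only [G]; ring
    rw [e, norm_mul, norm_inv, Complex.norm_real, Real.norm_eq_abs, abs_of_pos (EE_pos M _),
      inv_mul_le_iff₀ (EE_pos M _)]
    refine (norm_sub_le _ _).trans ((add_le_add s1 s0).trans ?_)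
    have hh : 2 * (A * cM M) ≤ 1 / 2 * dist y y' := by
      have := mul_le_mul_of_nonneg_right hc (dist_nonneg (x := y) (y := y'))
      rw [hA]; linarith
    have : ((1 / 2 : NNReal) : ℝ) = 1 / 2 := by norm_num
    rw [this]
    calc A * EE M (PP z) * cM M + A * 1 * cM M ≤ EE M (PP z) * (2 * (A * cM M)) := by nlinarith
      _ ≤ _ := by gcongr
  have hfix := hcontr.fixedPoint_isFixedPt
  set y := ContractingWith.fixedPoint Φ hcontr with hy
  refine ⟨M, V y, hV y, hLS y, fun z hz i => ?_⟩
  have e : y z = G y (PP z) := by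
    conv_lhs => rw [← hfix.eq]
    exact hΦ y z
  rw [PP_id hz] at e
  have : V y z i = EE M z * y z i := by simp [V]
  rw [this, e]
  simp only [G]
  rw [mul_inv_cancel_left₀ (hEne z)]

/-- untwisted right-hand side -/
noncomputable def GG {n : ℕ} (B1 B2 : Fin n → Fin n → ℂ → ℂ) (u : Fin n → ℂ → ℂ)
    (i : Fin n) (ζ : ℂ) : ℂ :=
  ∑ l, (B1 i l ζ * u l ζ + B2 i l ζ * (starRingEnd ℂ) (u l ζ))

lemma GG_CH {α : ℝ} (hα : 0 < α) (hα₁ : α < 1) {n m : ℕ} {B1 B2 : Fin n → Fin n → ℂ → ℂ}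
    (c1 : ∀ i l, CH α Set.univ m (B1 i l)) (c2 : ∀ i l, CH α Set.univ m (B2 i l))
    {u : Fin n → ℂ → ℂ} (hu : ∀ i, CH α Set.univ m (u i)) (i : Fin n) :
    CH α Set.univ m (GG B1 B2 u i) := by
  unfold GG
  exact CH_sum m _ fun l _ => CH_add m (CH_mul hα hα₁ convex_univ m (c1 i l) (hu l))
    (CH_mul hα hα₁ convex_univ m (c2 i l) (CH_conj m (hu l)))

lemma JJ_rho_zero {f : ℂ → ℂ} (hf : ∀ z, 2 ≤ ‖z‖ → f z = 0) {z : ℂ} (hz : ‖z‖ < 2) :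
    JJ rho f 0 z = 0 := by
  unfold JJ
  rw [← integral_zero ℂ ℂ]
  congr 1; ext w
  rcases lt_or_ge ‖w‖ 4 with h | h
  · rw [rho_zero h, mul_zero]
  · rw [hf, zero_mul]
    have := norm_sub_norm_le w z
    rw [norm_sub_rev] at this
    simp only [pow_zero, Complex.ofReal_one, one_mul]
    linarith

lemma solve {α : ℝ} (hα : 0 < α) (hα₁ : α < 1) {n m : ℕ} (B1 B2 : Fin n → Fin n → ℂ → ℂ)
    (c1 : ∀ i l, CH α Set.univ m (B1 i l)) (c2 : ∀ i l, CH α Set.univ m (B2 i l))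
    (z1 : ∀ i l z, 2 ≤ ‖z‖ → B1 i l z = 0) (z2 : ∀ i l z, 2 ≤ ‖z‖ → B2 i l z = 0)
    (j : ℕ) (b : Fin n → ℂ) :
    ∃ u : Fin n → ℂ → ℂ, (∀ i, CH α Set.univ (m + 1) (u i)) ∧
      (∀ i z, ‖z‖ < 2 → ∃ a, HasFDerivAt (u i) (WL a (GG B1 B2 u i z)) z) ∧
      ∃ v : ℂ → Fin n → ℂ, Continuous v ∧ v 0 = b ∧
        ∀ z, ‖z‖ ≤ 2 → ∀ i, u i z = z ^ j * v z i := by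
  set q : ℂ → ℂ := fun ζ => ((starRingEnd ℂ) ζ / ζ) ^ j with hq
  have hq1 : ∀ z, ‖q z‖ ≤ 1 := fun z => by
    rw [hq]; simp only
    rw [norm_pow, norm_div, RCLike.norm_conj]
    exact pow_le_one₀ (by positivity) (div_self_le_one _)
  have hqm : Measurable q :=
    (Complex.continuous_conj.measurable.div measurable_id).pow_const j
  have hqz : ∀ z, q z * z ^ j = (starRingEnd ℂ) z ^ j := fun z => by
    rw [hq]; simp only
    rcases eq_or_ne z 0 with rfl | h
    · rcases Nat.eq_zero_or_pos j with rfl | h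
      · simp
      · simp [h.ne']
    · rw [div_pow, div_mul_cancel₀ _ (pow_ne_zero _ h)]
  have cc1 : ∀ i l, CH α Set.univ 0 (B1 i l) := fun i l =>
    CH_le hα hα₁ convex_univ (Nat.zero_le m) (c1 i l)
  have cc2 : ∀ i l, CH α Set.univ 0 (B2 i l) := fun i l =>
    CH_le hα hα₁ convex_univ (Nat.zero_le m) (c2 i l)
  obtain ⟨M, v, hv, hLS, hfix⟩ := fixed_pt B1 B2 q (fun i l => CH_continuous hα (cc1 i l))
    (fun i l => CH_continuous hα (cc2 i l)) z1 z2 hq1 hqm b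
  set f := FF B1 B2 q v with hf
  choose c hc using fun i => TT_pow (hLS i) j
  let h : Fin n → ℂ → ℂ := fun i z => ∑ i' ∈ Finset.range j, z ^ i' * c i i' +
    z ^ j * (b i + HH M (f i) z - SS M (f i) 0)
  let u : Fin n → ℂ → ℂ := fun i z => TT (fun ζ => f i ζ * ζ ^ j) z + h i z
  have hh : ∀ i, Differentiable ℂ (h i) := fun i => by
    have := HH_diff M (hLS i)
    simp only [h]
    refine Differentiable.add (Differentiable.fun_sum fun i' _ => ?_) ?_ <;> fun_prop
  have huv : ∀ z, ‖z‖ ≤ 2 → ∀ i, u i z = z ^ j * v z i := fun z hz i => by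
    rw [hfix z hz i]
    have := hc i z hz
    simp only [u, h, SS]
    linear_combination -this
  have hG : ∀ i, (fun ζ => f i ζ * ζ ^ j) = GG B1 B2 u i := fun i => by
    ext ζ
    simp only [hf, FF, GG, Finset.sum_mul]
    refine Finset.sum_congr rfl fun l _ => ?_
    rcases le_or_gt ‖ζ‖ 2 with hz | hz
    · rw [huv ζ hz l, map_mul, map_pow, ← hqz]; ring
    · rw [z1 i l ζ hz.le, z2 i l ζ hz.le]; ring
  have hu : ∀ i z, u i z = TT (GG B1 B2 u i) z + h i z := fun i z => by
    rw [← hG i]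
  have hhs : ∀ i m, CH α Set.univ m (h i) := fun i m =>
    CH_smooth hα₁ convex_univ m ((hh i).contDiff.restrict_scalars ℝ)
  have hLB : ∀ i, LB (GG B1 B2 u i) := fun i => by
    rw [← hG i]; exact ((hLS i).mul_cont (by fun_prop)).1
  have hboot : ∀ m' ≤ m + 1, ∀ i, CH α Set.univ m' (u i) := by
    intro m'
    induction m' with
    | zero => 
      intro _ i
      exact CH_congr 0 (fun z _ => (hu i z).symm) (CH_add 0 (TT_R0 hα hα₁ (hLB i)) (hhs i 0))
    | succ m' ih =>
      intro hm i
      refine CH_congr (m' + 1) (fun z _ => (hu i z).symm)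
        (CH_add (m' + 1) (TT_CH hα hα₁ m' ?_) (hhs i _))
      refine GG_CH hα hα₁ (fun i l => ?_) (fun i l => ?_) (ih (by omega)) i
      · exact CH_le hα hα₁ convex_univ (by omega) (c1 i l)
      · exact CH_le hα hα₁ convex_univ (by omega) (c2 i l)
  refine ⟨u, hboot _ le_rfl, fun i z hz => ?_, v, hv, ?_, huv⟩
  · obtain ⟨g1, -, hg1⟩ := TT_R1 hα hα₁ (GG_CH hα hα₁ cc1 cc2 (hboot 0 (by omega)) i)
    have e := hg1 z
    rw [JJ_rho_zero (fun z hz => ?_) hz, add_zero] at e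
    · have e2 := hw_of_hasDerivAt (s := Set.univ) ((hh i z).hasDerivAt)
      have e3 := hw_add e.hasFDerivWithinAt e2
      rw [hasFDerivWithinAt_univ, add_zero] at e3
      refine ⟨_, e3.congr_of_eventuallyEq (Filter.Eventually.of_forall fun z => hu i z)⟩
    · unfold GG
      refine Finset.sum_eq_zero fun l _ => ?_
      rw [z1 i l z hz, z2 i l z hz]; ring
  · ext i
    rw [hfix 0 (by simp) i]; ring

lemma contDiff_of_CH {α : ℝ} (hα : 0 < α) : ∀ (m : ℕ) {f : ℂ → ℂ}, CH α Set.univ m f → ContDiff ℝ m f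
  | 0, f, hf => by
      exact_mod_cast contDiff_zero.2 (CH_continuous hα hf)
  | (m + 1), f, ⟨f1, f2, h1, h2, h⟩ => by
      have e1 := contDiff_of_CH hα m h1
      have e2 := contDiff_of_CH hα m h2
      push_cast
      refine contDiff_succ_iff_hasFDerivAt.2 ⟨fun z => WL (f1 z) (f2 z), ?_, fun z => ?_⟩
      · unfold WL
        exact ((ContinuousLinearMap.mul ℝ ℂ).contDiff.comp e1).add
          (((ContinuousLinearMap.mul ℝ ℂ).contDiff.comp e2).clm_comp contDiff_const)
      · exact hasFDerivWithinAt_univ.1 (h z trivial)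

lemma contDiff_wZ {E : Type*} [NormedAddCommGroup E] [NormedSpace ℂ E] {f : ℂ → E} {m : ℕ}
    (hf : ContDiff ℝ (m + 1 : ℕ) f) : ContDiff ℝ m (wirtingerZ f) := by
  have h : ContDiff ℝ m (fderiv ℝ f) := hf.fderiv_right (by simp)
  unfold wirtingerZ
  have h1 : ContDiff ℝ m (fun z => fderiv ℝ f z 1) := h.clm_apply contDiff_const
  have h2 : ContDiff ℝ m (fun z => fderiv ℝ f z Complex.I) := h.clm_apply contDiff_const
  exact (h1.sub (h2.const_smul Complex.I)).const_smul (1 / 2 : ℂ)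

lemma contDiff_wZbar {E : Type*} [NormedAddCommGroup E] [NormedSpace ℂ E] {f : ℂ → E} {m : ℕ}
    (hf : ContDiff ℝ (m + 1 : ℕ) f) : ContDiff ℝ m (wirtingerZbar f) := by
  have h : ContDiff ℝ m (fderiv ℝ f) := hf.fderiv_right (by simp)
  unfold wirtingerZbar
  have h1 : ContDiff ℝ m (fun z => fderiv ℝ f z 1) := h.clm_apply contDiff_const
  have h2 : ContDiff ℝ m (fun z => fderiv ℝ f z Complex.I) := h.clm_apply contDiff_const
  exact (h1.add (h2.const_smul Complex.I)).const_smul (1 / 2 : ℂ)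

lemma wZ_add_iter : ∀ (i m : ℕ) {f g : ℂ → ℂ}, i ≤ m → ContDiff ℝ m f → ContDiff ℝ m g →
    wirtingerZ^[i] (fun z => f z + g z) = fun z => wirtingerZ^[i] f z + wirtingerZ^[i] g z
  | 0, m, f, g, _, _, _ => rfl
  | (i + 1), 0, f, g, h, _, _ => by omega
  | (i + 1), (m + 1), f, g, h, hf, hg => by
      have e : wirtingerZ (fun z => f z + g z) = fun z => wirtingerZ f z + wirtingerZ g z := by
        ext z
        have hf' := (hf.differentiable (by simp)) z
        have hg' := (hg.differentiable (by simp)) z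
        unfold wirtingerZ
        rw [fderiv_fun_add hf' hg']
        simp; ring
      simp only [Function.iterate_succ_apply, e]
      exact wZ_add_iter i m (by omega) (contDiff_wZ hf) (contDiff_wZ hg)

lemma wZ_pi {n : ℕ} {u : ℂ → Fin n → ℂ} {z : ℂ} (hu : DifferentiableAt ℝ u z) (l : Fin n) :
    wirtingerZ u z l = wirtingerZ (fun z => u z l) z := by
  unfold wirtingerZ
  rw [fderiv_apply hu]
  simp

lemma wZbar_pi {n : ℕ} {u : ℂ → Fin n → ℂ} {z : ℂ} (hu : DifferentiableAt ℝ u z) (l : Fin n) :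
    wirtingerZbar u z l = wirtingerZbar (fun z => u z l) z := by
  unfold wirtingerZbar
  rw [fderiv_apply hu]
  simp

lemma wZ_pi_iter {n : ℕ} : ∀ (i m : ℕ) {u : ℂ → Fin n → ℂ}, i ≤ m → ContDiff ℝ m u →
    ∀ z l, wirtingerZ^[i] u z l = wirtingerZ^[i] (fun z => u z l) z
  | 0, m, u, _, _, z, l => rfl
  | (i + 1), 0, u, h, _, _, _ => by omega
  | (i + 1), (m + 1), u, h, hu, z, l => by
      have e : (fun z => wirtingerZ u z l) = wirtingerZ (fun z => u z l) := by
        ext z; exact wZ_pi (hu.differentiable (by simp) z) l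
      simp only [Function.iterate_succ_apply, ← e]
      exact wZ_pi_iter i m (by omega) (contDiff_wZ hu) z l

lemma wZ_pow_iter (j : ℕ) (c : ℂ) (i : ℕ) : wirtingerZ^[i] (fun z : ℂ => c * z ^ j) =
    fun z => c * (j.descFactorial i : ℂ) * z ^ (j - i) := by
  induction i with
  | zero => simp
  | succ i ih =>
    rw [Function.iterate_succ_apply', ih]
    ext z
    have h := ((hasDerivAt_pow (j - i) z).const_mul (c * (j.descFactorial i : ℂ)))
    have := hw_of_hasDerivAt (s := Set.univ) h
    rw [hasFDerivWithinAt_univ] at this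
    rw [(wirtinger_of_hasFDerivAt this).1, Nat.descFactorial_succ, Nat.sub_sub]
    push_cast; ring

/-- coefficients of directional derivatives -/
noncomputable def QQ (d : ℂ → ℂ) : ℕ → ℕ → ℂ → ℂ
  | 0, 0 => d
  | 0, (_ + 1) => 0
  | (i + 1), 0 => wirtingerZ (QQ d i 0)
  | (i + 1), (l + 1) => fun z => wirtingerZ (QQ d i (l + 1)) z + wirtingerZbar (QQ d i l) z

lemma QQ_contDiff {d : ℂ → ℂ} : ∀ (i m l : ℕ), ContDiff ℝ (m + i : ℕ) d → ContDiff ℝ m (QQ d i l)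
  | 0, m, 0, h => h
  | 0, m, (_ + 1), _ => contDiff_const
  | (i + 1), m, 0, h => contDiff_wZ (QQ_contDiff i (m + 1) 0 (by convert h using 2; ring))
  | (i + 1), m, (l + 1), h => 
      (contDiff_wZ (QQ_contDiff i (m + 1) (l + 1) (by convert h using 2; ring))).add
      (contDiff_wZbar (QQ_contDiff i (m + 1) l (by convert h using 2; ring)))

lemma wZ_zero : wirtingerZ (0 : ℂ → ℂ) = 0 := by
  ext z; simp [wirtingerZ]
lemma wZbar_zero : wirtingerZbar (0 : ℂ → ℂ) = 0 := by
  ext z; simp [wirtingerZbar]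

lemma QQ_zero (d : ℂ → ℂ) : ∀ (i l : ℕ), i < l → QQ d i l = 0
  | 0, (_ + 1), _ => rfl
  | (i + 1), (l + 1), h => by
      simp only [QQ]
      rw [QQ_zero d i (l + 1) (by omega), QQ_zero d i l (by omega), wZ_zero, wZbar_zero]
      ext z; simp

lemma QQ_iter (d : ℂ → ℂ) (i : ℕ) : QQ d i 0 = wirtingerZ^[i] d := by
  induction i with
  | zero => rfl
  | succ i ih => rw [Function.iterate_succ_apply', ← ih]; rfl

lemma line_deriv {d : ℂ → ℂ} {ω x : ℂ} (hx : ω * x = (starRingEnd ℂ) ω) (i : ℕ) :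
    ∀ m : ℕ, ContDiff ℝ (m + i : ℕ) d →
    iteratedDeriv i (fun r : ℝ => d (r * ω)) =
      fun r : ℝ => ω ^ i * ∑ l ∈ Finset.range (i + 1), x ^ l * QQ d i l (r * ω) := by
  induction i with
  | zero => intro m _; ext r; simp [QQ]
  | succ i ih =>
    intro m hm
    have hm' : ContDiff ℝ ((m + 1) + i : ℕ) d := by convert hm using 2; push_cast; ring
    rw [iteratedDeriv_succ, ih (m + 1) hm']
    ext r
    have hQ : ∀ l, HasDerivAt (fun r : ℝ => QQ d i l (r * ω))
        (wirtingerZ (QQ d i l) (r * ω) * ω + wirtingerZbar (QQ d i l) (r * ω) * (ω * x)) r := by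
      intro l
      have h1 := hasFDerivAt_WL (((QQ_contDiff i (m + 1) l hm').differentiable (by simp)) (r * ω))
      have h2 : HasDerivAt (fun r : ℝ => (r : ℂ) * ω) ω r := by
        simpa using (Complex.ofRealCLM.hasDerivAt (x := r)).mul_const ω
      have h3 := h1.comp_hasDerivAt r h2
      rwa [WL_apply, ← hx] at h3
    have hS : HasDerivAt (fun r : ℝ => ω ^ i * ∑ l ∈ Finset.range (i + 1), x ^ l * QQ d i l (r * ω))
        (ω ^ i * ∑ l ∈ Finset.range (i + 1), x ^ l * (wirtingerZ (QQ d i l) (r * ω) * ω +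
          wirtingerZbar (QQ d i l) (r * ω) * (ω * x))) r :=
      (HasDerivAt.fun_sum fun l _ => (hQ l).const_mul (x ^ l)).const_mul _
    rw [hS.deriv, Finset.sum_range_succ' _ (i + 1)]
    simp only [QQ, mul_add, Finset.sum_add_distrib]
    have e := Finset.sum_range_succ' (fun l => x ^ l * wirtingerZ (QQ d i l) (r * ω)) (i + 1)
    rw [Finset.sum_range_succ, QQ_zero d i (i + 1) (by omega), wZ_zero] at e
    simp only [Pi.zero_apply, mul_zero, add_zero] at e
    have e1 : ∑ l ∈ Finset.range (i + 1), x ^ l * (wirtingerZ (QQ d i l) (r * ω) * ω) =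
        ω * ∑ l ∈ Finset.range (i + 1), x ^ l * wirtingerZ (QQ d i l) (r * ω) := by
      rw [Finset.mul_sum]; exact Finset.sum_congr rfl fun l _ => by ring
    have e2 : ∑ l ∈ Finset.range (i + 1), x ^ l * (wirtingerZbar (QQ d i l) (r * ω) * (ω * x)) =
        ω * ∑ l ∈ Finset.range (i + 1), x ^ (l + 1) * wirtingerZbar (QQ d i l) (r * ω) := by
      rw [Finset.mul_sum]; exact Finset.sum_congr rfl fun l _ => by ring
    rw [e1, e2, e]; ring

lemma one_dim {φ : ℝ → ℂ} : ∀ (j : ℕ), ContDiff ℝ j φ →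
    (φ =o[nhds 0] fun r : ℝ => r ^ j) → ∀ i ≤ j, iteratedDeriv i φ 0 = 0 := by
  have top : ∀ (j : ℕ), ContDiff ℝ j φ → (φ =o[nhds 0] fun r : ℝ => r ^ j) →
      (∀ i < j, iteratedDeriv i φ 0 = 0) → iteratedDeriv j φ 0 = 0 := by
    intro j hφ ho hi
    have ht := taylor_isLittleO_univ (x₀ := 0) hφ
    simp only [sub_zero] at ht
    have := ho.sub ht
    simp only [sub_sub_cancel, taylor_within_apply, iteratedDerivWithin_univ] at this
    have e : ∀ r : ℝ, ∑ k ∈ Finset.range (j + 1), ((k.factorial : ℝ)⁻¹ * (r - 0) ^ k) •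
        iteratedDeriv k φ 0 = r ^ j • ((j.factorial : ℝ)⁻¹ • iteratedDeriv j φ 0) := fun r => by
      rw [Finset.sum_range_succ, Finset.sum_eq_zero, zero_add, sub_zero, mul_comm, mul_smul]
      intro k hk; rw [hi k (by simpa using hk), smul_zero]
    simp only [e] at this
    by_contra hne
    set c := (j.factorial : ℝ)⁻¹ • iteratedDeriv j φ 0 with hc
    have hc0 : 0 < ‖c‖ := by
      rw [norm_pos_iff, hc]
      exact smul_ne_zero (by positivity) hne
    have h2 := (this.def (half_pos hc0)).filter_mono (nhdsWithin_le_nhds (s := {0}ᶜ))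
    obtain ⟨r, hr, hr0⟩ := (h2.and self_mem_nhdsWithin).exists
    rw [norm_smul, mul_comm] at hr
    have : 0 < ‖r ^ j‖ := norm_pos_iff.2 (pow_ne_zero _ hr0)
    have := le_of_mul_le_mul_right hr this
    linarith
  intro j
  induction j with
  | zero => 
    intro h1 h2 i hi
    obtain rfl : i = 0 := by omega
    exact top 0 h1 h2 (by simp)
  | succ j ih =>
    intro h1 h2
    have := ih (h1.of_le (by exact_mod_cast Nat.le_succ j)) (h2.trans (by
      exact (Asymptotics.isLittleO_pow_pow (𝕜 := ℝ) (Nat.lt_succ_self j)).trans_isBigO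
        (Asymptotics.isBigO_refl _ _)))
    intro i hi
    rcases Nat.lt_or_ge i (j + 1) with h | h
    · exact this i (by omega)
    · obtain rfl : i = j + 1 := by omega
      exact top _ h1 h2 fun i hi => this i (by omega)

lemma jet_zero {d : ℂ → ℂ} {j : ℕ} (hd : ContDiff ℝ j d)
    (ho : d =o[nhds 0] fun z => z ^ j) {i : ℕ} (hi : i ≤ j) : wirtingerZ^[i] d 0 = 0 := by
  have key : ∀ x : ℂ, ‖x‖ = 1 → ∑ l ∈ Finset.range (i + 1), x ^ l * QQ d i l 0 = 0 := by
    intro x hx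
    obtain ⟨y, hy⟩ := IsAlgClosed.exists_pow_nat_eq x (n := 2) (by norm_num)
    have hy1 : ‖y‖ = 1 := by
      have : ‖y‖ ^ 2 = 1 := by rw [← norm_pow, hy, hx]
      nlinarith [norm_nonneg y, sq_nonneg (‖y‖ - 1)]
    have hyy : (starRingEnd ℂ) y * y = 1 := by
      rw [mul_comm, Complex.mul_conj, Complex.normSq_eq_norm_sq, hy1]; simp
    set ω := (starRingEnd ℂ) y with hω
    have hω0 : ω ≠ 0 := left_ne_zero_of_mul_eq_one hyy
    have hωx : ω * x = (starRingEnd ℂ) ω := by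
      rw [← hy, hω, Complex.conj_conj, ← hω]; linear_combination y * hyy
    have hlin : Filter.Tendsto (fun r : ℝ => (r : ℂ) * ω) (nhds 0) (nhds 0) := by
      have : Continuous fun r : ℝ => (r : ℂ) * ω := by fun_prop
      simpa using this.tendsto 0
    have h1 := one_dim (φ := fun r : ℝ => d (r * ω)) j
      (hd.comp (Complex.ofRealCLM.contDiff.mul contDiff_const)) (by
        have := ho.comp_tendsto hlin
        refine this.trans_isBigO ?_
        refine Asymptotics.IsBigO.of_bound 1 (Filter.Eventually.of_forall fun r => ?_)
        simp [hω, hy1]) i hi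
    have h2 := congrFun (line_deriv hωx i (j - i) (d := d) (by rwa [Nat.sub_add_cancel hi])) 0
    rw [h1] at h2
    simp only [Complex.ofReal_zero, zero_mul] at h2
    exact (mul_eq_zero.1 h2.symm).resolve_left (pow_ne_zero _ hω0)
  let p : Polynomial ℂ := ∑ l ∈ Finset.range (i + 1), Polynomial.C (QQ d i l 0) * Polynomial.X ^ l
  have hp : p = 0 := by
    refine Polynomial.eq_zero_of_infinite_isRoot p ?_
    have hinf : (Metric.sphere (0 : ℂ) 1).Infinite := by
      refine (isPreconnected_sphere (by simp [Complex.rank_real_complex]) 0 1).infinite_of_nontrivial ?_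
      refine ⟨1, by simp, -1, by simp, ?_⟩
      norm_num
    refine hinf.mono fun x hx => ?_
    have := key x (by simpa using hx)
    simp only [Set.mem_ofPred_eq, Polynomial.IsRoot.def, p, Polynomial.eval_finsetSum]
    refine Eq.trans ?_ this
    refine Finset.sum_congr rfl fun l _ => ?_
    rw [Polynomial.eval_mul, Polynomial.eval_C, Polynomial.eval_pow, Polynomial.eval_X, mul_comm]
  have h0 : p.coeff 0 = QQ d i 0 0 := by
    simp [p, Polynomial.finsetSum_coeff, Polynomial.coeff_X_pow]
  rw [← QQ_iter, ← h0, hp]; simp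

lemma jet_sol {u v : ℂ → ℂ} {j : ℕ} (hu : ContDiff ℝ j u) (hv : ContinuousAt v 0)
    (h : ∀ z, ‖z‖ ≤ 2 → u z = z ^ j * v z) :
    (∀ i < j, wirtingerZ^[i] u 0 = 0) ∧ wirtingerZ^[j] u 0 = j.factorial * v 0 := by
  have hp : ContDiff ℝ j (fun z : ℂ => v 0 * z ^ j) := by fun_prop
  have hp' : ContDiff ℝ j (fun z : ℂ => (-v 0) * z ^ j) := by fun_prop
  have ho : (fun z => u z + (-v 0) * z ^ j) =o[nhds 0] fun z => z ^ j := by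
    have h1 : (fun z => v z - v 0) =o[nhds 0] fun _ : ℂ => (1 : ℂ) := by
      rw [Asymptotics.isLittleO_one_iff]
      simpa using hv.tendsto.sub_const (v 0)
    have h2 := (Asymptotics.isBigO_refl (fun z : ℂ => z ^ j) (nhds 0)).mul_isLittleO h1
    refine h2.congr' ?_ (Filter.Eventually.of_forall fun z => by simp)
    filter_upwards [Metric.closedBall_mem_nhds (0 : ℂ) (show (0 : ℝ) < 2 by norm_num)] with z hz
    rw [h z (by simpa using hz)]; ring
  have hz := fun i (hi : i ≤ j) => jet_zero (hu.add hp') ho hi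
  have key : ∀ i ≤ j, wirtingerZ^[i] u 0 = v 0 * (j.descFactorial i : ℂ) * 0 ^ (j - i) := by
    intro i hi
    have h1 := hz i hi
    have h2 := congrFun (wZ_add_iter i j hi hu hp') 0
    rw [wZ_pow_iter] at h2
    rw [h2] at h1
    simp only at h1
    linear_combination h1
  refine ⟨fun i hi => ?_, ?_⟩
  · rw [key i hi.le, zero_pow (by omega), mul_zero]
  · rw [key j le_rfl, Nat.descFactorial_self]; simp; ring

lemma main_induct {α : ℝ} (hα : 0 < α) (hα₁ : α < 1) {n m : ℕ} (B1 B2 : Fin n → Fin n → ℂ → ℂ)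
    (c1 : ∀ i l, CH α Set.univ m (B1 i l)) (c2 : ∀ i l, CH α Set.univ m (B2 i l))
    (z1 : ∀ i l z, 2 ≤ ‖z‖ → B1 i l z = 0) (z2 : ∀ i l z, 2 ≤ ‖z‖ → B2 i l z = 0)
    (a : ℕ → Fin n → ℂ) (j : ℕ) : j ≤ m + 2 →
    ∃ u : Fin n → ℂ → ℂ, (∀ i, CH α Set.univ (m + 1) (u i)) ∧
      (∀ i z, ‖z‖ < 2 → ∃ a, HasFDerivAt (u i) (WL a (GG B1 B2 u i z)) z) ∧
      ∀ s < j, ∀ i, wirtingerZ^[s] (u i) 0 = a s i := by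
  induction j with
  | zero =>
    intro _
    refine ⟨fun _ _ => 0, fun i => CH_const 0 _, fun i z _ => ⟨0, ?_⟩, by simp⟩
    have := hw_const 0 Set.univ z
    rw [hasFDerivWithinAt_univ] at this
    simpa [GG] using this
  | succ j ih =>
    intro hj
    obtain ⟨u, hu, hd, hjet⟩ := ih (by omega)
    obtain ⟨w, hw, hwd, v, hv, hv0, hwv⟩ := solve hα hα₁ B1 B2 c1 c2 z1 z2 j
      (fun i => (j.factorial : ℂ)⁻¹ * (a j i - wirtingerZ^[j] (u i) 0))
    have cu := fun i => contDiff_of_CH hα _ (hu i)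
    have cw := fun i => contDiff_of_CH hα _ (hw i)
    have hjw := fun i => jet_sol (j := j) (u := w i) (v := fun z => v z i)
      ((cw i).of_le (by exact_mod_cast (by omega : j ≤ m + 1)))
      ((continuous_apply i).comp hv).continuousAt (fun z hz => hwv z hz i)
    refine ⟨fun i z => u i z + w i z, fun i => CH_add _ (hu i) (hw i), fun i z hz => ?_,
      fun s hs i => ?_⟩
    · obtain ⟨a1, h1⟩ := hd i z hz
      obtain ⟨a2, h2⟩ := hwd i z hz
      have h3 := hw_add h1.hasFDerivWithinAt h2.hasFDerivWithinAt (s := Set.univ)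
      rw [hasFDerivWithinAt_univ] at h3
      have : GG B1 B2 u i z + GG B1 B2 w i z = GG B1 B2 (fun i z => u i z + w i z) i z := by
        simp only [GG, ← Finset.sum_add_distrib]
        refine Finset.sum_congr rfl fun l _ => ?_
        rw [map_add]; ring
      rw [this] at h3
      exact ⟨_, h3⟩
    · rw [wZ_add_iter s (m + 1) (by omega) (cu i) (cw i)]
      rcases Nat.lt_or_ge s j with h | h
      · simp only
        rw [hjet s h i, (hjw i).1 s h, add_zero]
      · obtain rfl : s = j := by omega
        have hf : (s.factorial : ℂ) ≠ 0 := by exact_mod_cast s.factorial_ne_zero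
        simp only
        rw [(hjw i).2, hv0, mul_inv_cancel_left₀ hf]; ring

/-- jet interpolation for generalized holomorphic vectors. For
`B₁, B₂ ∈ C^{k-1,α}(D)`, `k ≥ 1`, `0 < α < 1`, and any `a₀,…,a_k ∈ ℂⁿ`, there is a
solution `u ∈ C^{k,α}(D̄,ℂⁿ)` of `∂u/∂ζ̄ = B₁u + B₂ū` with `∂_ζ^j u(0) = a_j`,
`0 ≤ j ≤ k`. -/
theorem stmt15 (n : ℕ) (k : ℕ) (hk : 1 ≤ k) (α : ℝ) (hα₀ : 0 < α) (hα₁ : α < 1)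
    (B₁ B₂ : ℂ → Matrix (Fin n) (Fin n) ℂ)
    (hB₁ : ∀ i j, HolderOn (k - 1) α (closure unitDisc) (fun ζ => B₁ ζ i j))
    (hB₂ : ∀ i j, HolderOn (k - 1) α (closure unitDisc) (fun ζ => B₂ ζ i j))
    (a : ℕ → (Fin n → ℂ)) :
    ∃ u : ℂ → (Fin n → ℂ),
      HolderOn k α (closure unitDisc) u ∧
      (∀ ζ ∈ unitDisc, wirtingerZbar u ζ = B₁ ζ *ᵥ u ζ + B₂ ζ *ᵥ vecConj (u ζ)) ∧
      ∀ j ≤ k, (wirtingerZ)^[j] u 0 = a j := by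
  obtain ⟨m, rfl⟩ : ∃ m, k = m + 1 := ⟨k - 1, by omega⟩
  simp only [Nat.add_sub_cancel] at hB₁ hB₂
  have hcl : closure unitDisc = Metric.closedBall (0 : ℂ) 1 := closure_ball 0 one_ne_zero
  rw [hcl] at hB₁ hB₂ ⊢
  have hs : UniqueDiffOn ℝ (Metric.closedBall (0 : ℂ) 1) := by
    refine uniqueDiffOn_convex (convex_closedBall 0 1) ?_
    rw [interior_closedBall _ one_ne_zero]
    exact ⟨0, by simp⟩
  choose B1 c1 e1 z1 using fun i j => exists_extension hα₀ hα₁ m (CH_of_HolderOn hs m (hB₁ i j))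
  choose B2 c2 e2 z2 using fun i j => exists_extension hα₀ hα₁ m (CH_of_HolderOn hs m (hB₂ i j))
  obtain ⟨u, hu, hd, hjet⟩ := main_induct hα₀ hα₁ B1 B2 c1 c2 z1 z2 a (m + 2) le_rfl
  have cU : ContDiff ℝ (m + 1 : ℕ) (fun z i => u i z) :=
    contDiff_pi.2 fun i => contDiff_of_CH hα₀ _ (hu i)
  refine ⟨fun z i => u i z, ?_, fun ζ hζ => ?_, fun j hj => ?_⟩
  · exact HolderOn_pi hs fun i => HolderOn_of_CH hα₀ hs 1 (fun x hx => by simpa using hx) _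
      (CH_mono (Set.subset_univ _) _ (hu i))
  · have hζ1 : ‖ζ‖ < 1 := by simpa [unitDisc] using hζ
    ext i
    rw [wZbar_pi (cU.differentiable (by simp) ζ)]
    obtain ⟨a', ha⟩ := hd i ζ (by linarith)
    rw [(wirtinger_of_hasFDerivAt ha).2]
    simp only [GG, Pi.add_apply, Matrix.mulVec, dotProduct, vecConj, ← Finset.sum_add_distrib]
    refine Finset.sum_congr rfl fun l _ => ?_
    rw [e1 i l ζ hζ1.le, e2 i l ζ hζ1.le]
  · ext i
    rw [wZ_pi_iter j (m + 1) hj cU]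
    exact hjet j (by omega) i
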